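/- arXiv:0706.3478 — 3 statements merged into one kernel-verified Lean document; each statement's English description precedes it below -/
import Mathlib

section
/- Suppose 0 < j ≤ g/3. Then I ∩ R^i_{(j)} = {0} for every integer i with 2i − j ≤ g, and there is an isomorphism of sl₂-modules 𝓡_{(j)} ≅ ⊕_{i=j+1}^{2j} V(g−2i+j)^{⊕ν(i,j)}, where ν(i, j) is the number of partitions of j into exactly i − j (positive) parts. -/
/- We model `R = ℚ[x₁, x₂, …]` as `MvPolynomial ℕ ℚ`, the variable of index `v`
representing `x_{v+1}` (so `x_k = X (k-1)` for `k ≥ 1`). -/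

open MvPolynomial

noncomputable section

/-- Codimension grading: `codim x_{v+1} = v + 1`. -/
def codimW (d : ℕ →₀ ℕ) : ℕ := d.sum fun v e => (v + 1) * e

/-- Level grading: `ℓ(x_{v+1}) = v`. -/
def levelW (d : ℕ →₀ ℕ) : ℕ := d.sum fun v e => v * e

/-- `R^i_{(j)}`: the ℚ-span of the monomials of codimension `i` and level `j`. -/
def Rij (i j : ℕ) : Submodule ℚ (MvPolynomial ℕ ℚ) :=
  Submodule.span ℚ
    { p | ∃ d : ℕ →₀ ℕ, codimW d = i ∧ levelW d = j ∧ p = monomial d (1 : ℚ) }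

/-- Polishchuk's operator
`𝒟 = -g ∂₁ + (1/2) ∑_{m,n ≥ 1} binom(m+n, n) x_{m+n-1} ∂_m ∂_n`; in our indexing,
with `a = m−1`, `b = n−1`, the second term is
`(1/2) ∑_{a,b ≥ 0} binom(a+b+2, b+1) X(a+b) ∂_{X a} ∂_{X b}`.  On a given polynomial
`p` only the finitely many terms with both variables occurring in `p` are nonzero, so
the sum may be cut off beyond all variable indices of `p`. -/
def Dop (g : ℕ) (p : MvPolynomial ℕ ℚ) : MvPolynomial ℕ ℚ :=
  -(g : ℚ) • pderiv 0 p +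
    (1/2 : ℚ) •
      ∑ a ∈ Finset.range (p.vars.sup id + 1), ∑ b ∈ Finset.range (p.vars.sup id + 1),
        (((a + b + 2).choose (b + 1) : ℚ)) • (X (a + b) * pderiv a (pderiv b p))

/-- `R^{>g}`: span of monomials of codimension `> g`. -/
def Rgt (g : ℕ) : Submodule ℚ (MvPolynomial ℕ ℚ) :=
  Submodule.span ℚ { p | ∃ d : ℕ →₀ ℕ, g < codimW d ∧ p = monomial d (1 : ℚ) }

/-- `Fil¹R^g`: span of monomials of codimension `g` and level `≥ 1`. -/
def Fil1Rg (g : ℕ) : Submodule ℚ (MvPolynomial ℕ ℚ) :=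
  Submodule.span ℚ
    { p | ∃ d : ℕ →₀ ℕ, codimW d = g ∧ 1 ≤ levelW d ∧ p = monomial d (1 : ℚ) }

/-- Polishchuk's ideal of universal relations `I = R^{>g} + ∑_{n ≥ 0} 𝒟ⁿ(Fil¹R^g)`. -/
def Ipol (g : ℕ) : Submodule ℚ (MvPolynomial ℕ ℚ) :=
  Rgt g ⊔ ⨆ n : ℕ, Submodule.span ℚ ((Dop g)^[n] '' (Fil1Rg g : Set (MvPolynomial ℕ ℚ)))

/-- `R_{(j)} = ⊕_i R^i_{(j)}`: span of all monomials of level `j`. -/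
def Rlev (j : ℕ) : Submodule ℚ (MvPolynomial ℕ ℚ) :=
  Submodule.span ℚ { p | ∃ d : ℕ →₀ ℕ, levelW d = j ∧ p = monomial d (1 : ℚ) }

/-- `ν(i,j)`: the number of partitions of `j` into exactly `i − j` (positive) parts. -/
def nuIJ (i j : ℕ) : ℕ :=
  Fintype.card { p : Nat.Partition j // p.parts.card = i - j }

/-- Model of the irreducible sl₂-module `V(n) = Symⁿ(standard)`: coordinates with
respect to a basis `b_0, …, b_n` with `h b_k = (n−2k) b_k`, `e b_k = (n−k+1) b_{k−1}`,
`f b_k = (k+1) b_{k+1}`.  The operator `e` in coordinates: -/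
def eV (n : ℕ) (v : Fin (n + 1) → ℚ) : Fin (n + 1) → ℚ :=
  fun k => if h : (k : ℕ) + 1 < n + 1 then ((n : ℚ) - (k : ℕ)) * v ⟨(k : ℕ) + 1, h⟩ else 0

/-- The operator `f` on `V(n)` in coordinates. -/
def fV (n : ℕ) (v : Fin (n + 1) → ℚ) : Fin (n + 1) → ℚ :=
  fun k => ((k : ℕ) : ℚ) * v ⟨(k : ℕ) - 1, by omega⟩

/-- The operator `h` on `V(n)` in coordinates. -/
def hV (n : ℕ) (v : Fin (n + 1) → ℚ) : Fin (n + 1) → ℚ :=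
  fun k => ((n : ℚ) - 2 * (k : ℕ)) * v k

/-- The target sl₂-module `⊕_{i=j+1}^{2j} V(g−2i+j)^{⊕ν(i,j)}`. -/
def Tspace5 (g j : ℕ) : Type :=
  (i : Finset.Icc (j + 1) (2 * j)) → Fin (nuIJ (i : ℕ) j) → Fin (g + j - 2 * (i : ℕ) + 1) → ℚ

instance (g j : ℕ) : AddCommGroup (Tspace5 g j) := by unfold Tspace5; infer_instance
instance (g j : ℕ) : Module ℚ (Tspace5 g j) := by unfold Tspace5; infer_instance

def eT5 (g j : ℕ) (v : Tspace5 g j) : Tspace5 g j :=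
  fun i m => eV (g + j - 2 * (i : ℕ)) (v i m)
def fT5 (g j : ℕ) (v : Tspace5 g j) : Tspace5 g j :=
  fun i m => fV (g + j - 2 * (i : ℕ)) (v i m)
def hT5 (g j : ℕ) (v : Tspace5 g j) : Tspace5 g j :=
  fun i m => hV (g + j - 2 * (i : ℕ)) (v i m)

/-- The span of the monomials with exponent in `S`. -/
def monSpan (S : Set (ℕ →₀ ℕ)) : Submodule ℚ (MvPolynomial ℕ ℚ) :=
  Submodule.span ℚ ((fun d => monomial d (1 : ℚ)) '' S)

lemma mem_monSpan {S : Set (ℕ →₀ ℕ)} {p : MvPolynomial ℕ ℚ} :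
    p ∈ monSpan S ↔ ∀ d, coeff d p ≠ 0 → d ∈ S := by
  constructor
  · intro hp
    induction hp using Submodule.span_induction with
    | mem x hx =>
      obtain ⟨e, he, rfl⟩ := hx
      intro d hd
      rw [coeff_monomial] at hd
      split_ifs at hd with h
      · exact h ▸ he
      · exact absurd rfl hd
    | zero => simp
    | add x y _ _ hx hy =>
      intro d hd
      by_cases h : coeff d x = 0
      · exact hy d (by simpa [h] using hd)
      · exact hx d h
    | smul a x _ hx =>
      intro d hd
      exact hx d (by intro h; simp [h] at hd)
  · intro h
    rw [p.as_sum]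
    refine Submodule.sum_mem _ fun d hd => ?_
    have : monomial d (coeff d p) = coeff d p • monomial d (1 : ℚ) := by simp [smul_monomial]
    rw [this]
    exact Submodule.smul_mem _ _ (Submodule.subset_span ⟨d, h d (by simpa using hd), rfl⟩)

lemma monomial_mem_monSpan {S : Set (ℕ →₀ ℕ)} {d : ℕ →₀ ℕ} (hd : d ∈ S) :
    monomial d (1 : ℚ) ∈ monSpan S :=
  Submodule.subset_span ⟨d, hd, rfl⟩

lemma monSpan_le {S : Set (ℕ →₀ ℕ)} {W : Submodule ℚ (MvPolynomial ℕ ℚ)} :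
    monSpan S ≤ W ↔ ∀ d ∈ S, monomial d (1 : ℚ) ∈ W := by
  rw [monSpan, Submodule.span_le, Set.image_subset_iff]
  rfl

lemma monSpan_mono {S T : Set (ℕ →₀ ℕ)} (h : S ⊆ T) : monSpan S ≤ monSpan T :=
  Submodule.span_mono (Set.image_mono h)

lemma Rij_eq (i j : ℕ) : Rij i j = monSpan {d | codimW d = i ∧ levelW d = j} := by
  unfold Rij monSpan
  congr 1
  ext p
  constructor
  · rintro ⟨d, h1, h2, rfl⟩; exact ⟨d, ⟨h1, h2⟩, rfl⟩
  · rintro ⟨d, ⟨h1, h2⟩, rfl⟩; exact ⟨d, h1, h2, rfl⟩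

lemma Rgt_eq (g : ℕ) : Rgt g = monSpan {d | g < codimW d} := by
  unfold Rgt monSpan
  congr 1
  ext p
  constructor
  · rintro ⟨d, h, rfl⟩; exact ⟨d, h, rfl⟩
  · rintro ⟨d, h, rfl⟩; exact ⟨d, h, rfl⟩

lemma Fil1Rg_eq (g : ℕ) : Fil1Rg g = monSpan {d | codimW d = g ∧ 1 ≤ levelW d} := by
  unfold Fil1Rg monSpan
  congr 1
  ext p
  constructor
  · rintro ⟨d, h1, h2, rfl⟩; exact ⟨d, ⟨h1, h2⟩, rfl⟩
  · rintro ⟨d, ⟨h1, h2⟩, rfl⟩; exact ⟨d, h1, h2, rfl⟩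

lemma Rlev_eq (j : ℕ) : Rlev j = monSpan {d | levelW d = j} := by
  unfold Rlev monSpan
  congr 1
  ext p
  constructor
  · rintro ⟨d, h, rfl⟩; exact ⟨d, h, rfl⟩
  · rintro ⟨d, h, rfl⟩; exact ⟨d, h, rfl⟩

lemma codimW_add (d e : ℕ →₀ ℕ) : codimW (d + e) = codimW d + codimW e :=
  Finsupp.sum_add_index' (by simp) (by intros; ring)

lemma levelW_add (d e : ℕ →₀ ℕ) : levelW (d + e) = levelW d + levelW e :=
  Finsupp.sum_add_index' (by simp) (by intros; ring)

lemma codimW_single (v e : ℕ) : codimW (Finsupp.single v e) = (v + 1) * e :=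
  Finsupp.sum_single_index (by simp)

lemma levelW_single (v e : ℕ) : levelW (Finsupp.single v e) = v * e :=
  Finsupp.sum_single_index (by simp)

lemma codimW_le_two_mul_levelW {d : ℕ →₀ ℕ} (hd : d 0 = 0) : codimW d ≤ 2 * levelW d := by
  unfold codimW levelW Finsupp.sum
  rw [Finset.mul_sum]
  refine Finset.sum_le_sum fun v hv => ?_
  have : v ≠ 0 := by rintro rfl; exact (Finsupp.mem_support_iff.mp hv) hd
  rw [← mul_assoc]
  exact Nat.mul_le_mul_right _ (by omega)

lemma codimW_erase (d : ℕ →₀ ℕ) : codimW d = codimW (d.erase 0) + d 0 := by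
  conv_lhs => rw [← Finsupp.erase_add_single 0 d]
  rw [codimW_add, codimW_single]; ring

lemma levelW_erase (d : ℕ →₀ ℕ) : levelW (d.erase 0) = levelW d := by
  conv_rhs => rw [← Finsupp.erase_add_single 0 d]
  rw [levelW_add, levelW_single]; ring

lemma codimW_le_of_levelW (d : ℕ →₀ ℕ) : codimW d ≤ 2 * levelW d + d 0 := by
  have := codimW_le_two_mul_levelW (d := d.erase 0) (by simp)
  rw [levelW_erase] at this
  rw [codimW_erase]
  omega

lemma levelW_lt_codimW {d : ℕ →₀ ℕ} (h : 0 < levelW d) : levelW d + d 0 < codimW d := by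
  have h1 := codimW_erase d
  rw [← levelW_erase] at h ⊢
  have h2 : levelW (d.erase 0) < codimW (d.erase 0) := by
    obtain ⟨v, hv⟩ : ∃ v, v ∈ (d.erase 0).support := by
      by_contra! hc
      have : (d.erase 0).support = ∅ := Finset.eq_empty_of_forall_notMem hc
      rw [levelW, Finsupp.sum, this, Finset.sum_empty] at h
      exact lt_irrefl _ h
    refine Finset.sum_lt_sum (fun v _ => Nat.mul_le_mul_right _ (Nat.le_succ v)) ⟨v, hv, ?_⟩
    exact Nat.mul_lt_mul_of_pos_right (Nat.lt_succ_self v)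
      (Nat.pos_of_ne_zero (Finsupp.mem_support_iff.mp hv))
  omega

/-- Polishchuk's operator with the double sum cut off at `N`. -/
def Dcut (g N : ℕ) : MvPolynomial ℕ ℚ →ₗ[ℚ] MvPolynomial ℕ ℚ :=
  -(g : ℚ) • (pderiv 0).toLinearMap +
    (1/2 : ℚ) •
      ∑ a ∈ Finset.range N, ∑ b ∈ Finset.range N,
        (((a + b + 2).choose (b + 1) : ℚ)) •
          (LinearMap.mulLeft ℚ (X (a + b)) ∘ₗ (pderiv a).toLinearMap ∘ₗ (pderiv b).toLinearMap)

lemma Dcut_apply (g N : ℕ) (p : MvPolynomial ℕ ℚ) :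
    Dcut g N p = -(g : ℚ) • pderiv 0 p +
    (1/2 : ℚ) •
      ∑ a ∈ Finset.range N, ∑ b ∈ Finset.range N,
        (((a + b + 2).choose (b + 1) : ℚ)) • (X (a + b) * pderiv a (pderiv b p)) := by
  simp [Dcut, LinearMap.sum_apply]

lemma pderiv_eq_zero_of_vars_sup_lt {p : MvPolynomial ℕ ℚ} {a : ℕ}
    (h : p.vars.sup id < a) : pderiv a p = 0 :=
  pderiv_eq_zero_of_notMem_vars fun ha => absurd (Finset.le_sup (f := id) ha) (not_le.mpr h)

lemma pderiv_pderiv_comm (a b : ℕ) (p : MvPolynomial ℕ ℚ) :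
    pderiv a (pderiv b p) = pderiv b (pderiv a p) := by
  have h : ⁅(pderiv a : Derivation ℚ (MvPolynomial ℕ ℚ) (MvPolynomial ℕ ℚ)),
      (pderiv b : Derivation ℚ (MvPolynomial ℕ ℚ) (MvPolynomial ℕ ℚ))⁆ = 0 := by
    refine derivation_ext fun v => ?_
    by_cases ha : v = a <;> by_cases hb : v = b <;>
      simp [Derivation.commutator_apply, pderiv_X, Pi.single_apply, ha, hb]
    all_goals split_ifs <;> simp
  have := congrArg (fun D => D p) h
  simpa [Derivation.commutator_apply, sub_eq_zero] using this

lemma Dop_eq_Dcut {g N : ℕ} {p : MvPolynomial ℕ ℚ} (h : p.vars.sup id + 1 ≤ N) :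
    Dop g p = Dcut g N p := by
  rw [Dcut_apply, Dop]
  congr 2
  have hsub : Finset.range (p.vars.sup id + 1) ⊆ Finset.range N := by
    simpa using h
  rw [← Finset.sum_subset hsub]
  · refine Finset.sum_congr rfl fun a _ => Finset.sum_subset hsub fun b _ hb => ?_
    rw [pderiv_eq_zero_of_vars_sup_lt (p := p) (a := b) (by simpa using hb)]
    simp
  · intro a _ ha
    refine Finset.sum_eq_zero fun b _ => ?_
    rw [pderiv_pderiv_comm, pderiv_eq_zero_of_vars_sup_lt (p := p) (a := a) (by simpa using ha)]
    simp

/-- Polishchuk's operator as a linear map. -/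
def DopL (g : ℕ) : MvPolynomial ℕ ℚ →ₗ[ℚ] MvPolynomial ℕ ℚ where
  toFun := Dop g
  map_add' p q := by
    let N := (p.vars.sup id + 1) + (q.vars.sup id + 1) + ((p + q).vars.sup id + 1)
    rw [Dop_eq_Dcut (N := N) (by omega), Dop_eq_Dcut (p := p) (N := N) (by omega),
      Dop_eq_Dcut (p := q) (N := N) (by omega), map_add]
  map_smul' c p := by
    let N := (p.vars.sup id + 1) + ((c • p).vars.sup id + 1)
    rw [Dop_eq_Dcut (N := N) (by omega), Dop_eq_Dcut (p := p) (N := N) (by omega), map_smul]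
    rfl

lemma DopL_apply (g : ℕ) (p : MvPolynomial ℕ ℚ) : DopL g p = Dop g p := rfl

lemma Dcut_X_zero_mul (g N : ℕ) (p : MvPolynomial ℕ ℚ) :
    Dcut g (N + 1) (X 0 * p) = X 0 * Dcut g (N + 1) p +
      (-(g : ℚ) • p + ∑ b ∈ Finset.range (N + 1), ((b : ℚ) + 2) • (X b * pderiv b p)) := by
  have key : ∀ a b : ℕ, pderiv a (pderiv b (X 0 * p)) =
      (if a = 0 then pderiv b p else 0) + (if b = 0 then pderiv a p else 0) +
        X 0 * pderiv a (pderiv b p) := by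
    intro a b
    by_cases ha : a = 0 <;> by_cases hb : b = 0 <;>
      simp [pderiv_X, ha, hb, eq_comm] <;> ring
  rw [Dcut_apply, Dcut_apply]
  simp only [key, mul_add, smul_add, Finset.sum_add_distrib]
  have s1 : ∑ a ∈ Finset.range (N + 1), ∑ b ∈ Finset.range (N + 1),
      (((a + b + 2).choose (b + 1) : ℚ)) • (X (a + b) * (if a = 0 then pderiv b p else 0)) =
      ∑ b ∈ Finset.range (N + 1), ((b : ℚ) + 2) • (X b * pderiv b p) := by
    rw [Finset.sum_eq_single 0]
    · refine Finset.sum_congr rfl fun b _ => ?_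
      have : (0 + b + 2).choose (b + 1) = b + 2 := by
        rw [zero_add]; exact Nat.choose_succ_self_right (b + 1)
      rw [this]; simp
    · intro a _ ha; simp [ha]
    · simp
  have s2 : ∑ a ∈ Finset.range (N + 1), ∑ b ∈ Finset.range (N + 1),
      (((a + b + 2).choose (b + 1) : ℚ)) • (X (a + b) * (if b = 0 then pderiv a p else 0)) =
      ∑ b ∈ Finset.range (N + 1), ((b : ℚ) + 2) • (X b * pderiv b p) := by
    refine Finset.sum_congr rfl fun a _ => ?_
    rw [Finset.sum_eq_single 0]
    · simp
    · intro b _ hb; simp [hb]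
    · simp
  have s3 : ∑ a ∈ Finset.range (N + 1), ∑ b ∈ Finset.range (N + 1),
      (((a + b + 2).choose (b + 1) : ℚ)) • (X (a + b) * (X 0 * pderiv a (pderiv b p))) =
      X 0 * ∑ a ∈ Finset.range (N + 1), ∑ b ∈ Finset.range (N + 1),
      (((a + b + 2).choose (b + 1) : ℚ)) • (X (a + b) * pderiv a (pderiv b p)) := by
    simp only [Finset.mul_sum, mul_smul_comm]
    refine Finset.sum_congr rfl fun a _ => Finset.sum_congr rfl fun b _ => ?_
    congr 1
    ring
  rw [s1, s2, s3]
  have s4 : pderiv 0 (X 0 * p) = p + X 0 * pderiv 0 p := by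
    simp [pderiv_X, add_comm]
  rw [s4]
  simp only [mul_smul_comm]
  module

lemma sum_X_mul_pderiv_monomial {N : ℕ} {d : ℕ →₀ ℕ} (h : d.support ⊆ Finset.range N) :
    ∑ b ∈ Finset.range N, ((b : ℚ) + 2) • (X b * pderiv b (monomial d (1 : ℚ))) =
      (2 * (codimW d : ℚ) - levelW d) • monomial d (1 : ℚ) := by
  simp only [X_mul_pderiv_monomial, ← Nat.cast_smul_eq_nsmul ℚ, smul_smul]
  rw [← Finset.sum_smul]
  congr 1
  unfold codimW levelW Finsupp.sum
  push_cast
  rw [Finset.mul_sum, ← Finset.sum_sub_distrib, ← Finset.sum_subset h]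
  · exact Finset.sum_congr rfl fun b _ => by ring
  · intro b _ hb
    rw [Finsupp.notMem_support_iff.mp hb]; simp

/-- The relation `[𝒟, x₁] = h` of the `sl₂`-action. -/
lemma DopL_X_zero_mul {g i j : ℕ} {p : MvPolynomial ℕ ℚ} (hp : p ∈ Rij i j) :
    DopL g (X 0 * p) = X 0 * DopL g p + (2 * (i : ℚ) - j - g) • p := by
  rw [Rij_eq] at hp
  induction hp using Submodule.span_induction with
  | mem x hx =>
    obtain ⟨d, ⟨rfl, rfl⟩, rfl⟩ := hx
    beta_reduce
    obtain ⟨N, hN⟩ : ∃ N, N = (X 0 * monomial d (1 : ℚ)).vars.sup id +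
      (monomial d (1 : ℚ)).vars.sup id + d.support.sup id := ⟨_, rfl⟩
    have hs : d.support ⊆ Finset.range (N + 1) := fun v hv => by
      have := Finset.le_sup (f := id) hv
      simp only [id] at this
      rw [Finset.mem_range]; omega
    rw [DopL_apply, DopL_apply, Dop_eq_Dcut (N := N + 1) (by omega),
      Dop_eq_Dcut (p := monomial d 1) (N := N + 1) (by omega),
      Dcut_X_zero_mul, sum_X_mul_pderiv_monomial hs]
    module
  | zero => simp
  | add x y _ _ hx hy =>
    rw [mul_add, map_add, map_add, hx, hy]
    simp only [mul_add, smul_add]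
    abel
  | smul c x _ hx =>
    rw [mul_smul_comm, map_smul, map_smul, hx, mul_smul_comm, smul_add, smul_comm c]

lemma monomial_pderiv_cases (b : ℕ) (d : ℕ →₀ ℕ) (c : ℚ) :
    pderiv b (monomial d c) = 0 ∨
      ∃ e c', d = e + Finsupp.single b 1 ∧ pderiv b (monomial d c) = monomial e c' := by
  by_cases h : d b = 0
  · left; simp [pderiv_monomial, h]
  · right
    refine ⟨d - Finsupp.single b 1, c * d b, ?_, pderiv_monomial⟩
    exact (tsub_add_cancel_of_le (by simpa using Nat.one_le_iff_ne_zero.mpr h)).symm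

lemma DopL_monomial_mem (g : ℕ) (d : ℕ →₀ ℕ) :
    DopL g (monomial d 1) ∈ monSpan {e | codimW e + 1 = codimW d ∧ levelW e = levelW d} := by
  have hmon : ∀ (e : ℕ →₀ ℕ) (c : ℚ), codimW e + 1 = codimW d → levelW e = levelW d →
      monomial e c ∈ monSpan {e | codimW e + 1 = codimW d ∧ levelW e = levelW d} := by
    intro e c h1 h2
    rw [← mul_one c, ← smul_eq_mul, ← smul_monomial]
    exact Submodule.smul_mem _ _ (monomial_mem_monSpan ⟨h1, h2⟩)
  rw [DopL_apply, Dop]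
  refine Submodule.add_mem _ (Submodule.smul_mem _ _ ?_) (Submodule.smul_mem _ _
    (Submodule.sum_mem _ fun a _ => Submodule.sum_mem _ fun b _ => Submodule.smul_mem _ _ ?_))
  · rcases monomial_pderiv_cases 0 d 1 with h | ⟨e, c, rfl, h⟩ <;> rw [h]
    · exact Submodule.zero_mem _
    · refine hmon _ _ ?_ ?_ <;> simp [codimW_add, levelW_add, codimW_single, levelW_single]
  · rcases monomial_pderiv_cases b d 1 with h | ⟨e, c, rfl, h⟩ <;> rw [h]
    · simp
    · rcases monomial_pderiv_cases a e c with h' | ⟨e', c', rfl, h'⟩ <;> rw [h']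
      · simp
      · rw [X, monomial_mul]
        refine hmon _ _ ?_ ?_ <;>
          simp [codimW_add, levelW_add, codimW_single, levelW_single] <;> ring

lemma DopL_mem_Rij {g i j : ℕ} {p : MvPolynomial ℕ ℚ} (hp : p ∈ Rij (i + 1) j) :
    DopL g p ∈ Rij i j := by
  suffices Rij (i + 1) j ≤ (Rij i j).comap (DopL g) from this hp
  rw [Rij_eq, Rij_eq, monSpan_le]
  rintro d ⟨h, rfl⟩
  refine monSpan_mono ?_ (DopL_monomial_mem g d)
  rintro e ⟨h1, h2⟩
  exact ⟨by omega, h2⟩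

lemma DopL_eq_zero {g j : ℕ} {p : MvPolynomial ℕ ℚ} (hp : p ∈ Rij 0 j) :
    DopL g p = 0 := by
  suffices Rij 0 j ≤ LinearMap.ker (DopL g) from LinearMap.mem_ker.mp (this hp)
  rw [Rij_eq, monSpan_le]
  rintro d ⟨h, rfl⟩
  have := mem_monSpan.mp (DopL_monomial_mem g d)
  refine LinearMap.mem_ker.mpr (MvPolynomial.ext _ _ fun e => ?_)
  by_contra hc
  have h1 := (this e (by simpa using hc)).1
  omega

lemma DopL_mem_Rlev {g j : ℕ} {p : MvPolynomial ℕ ℚ} (hp : p ∈ Rlev j) :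
    DopL g p ∈ Rlev j := by
  suffices Rlev j ≤ (Rlev j).comap (DopL g) from this hp
  rw [Rlev_eq, monSpan_le]
  rintro d rfl
  exact monSpan_mono (fun e he => he.2) (DopL_monomial_mem g d)

lemma DopL_pow_mem_Rij {g i j : ℕ} (k : ℕ) {p : MvPolynomial ℕ ℚ} (hp : p ∈ Rij (i + k) j) :
    (DopL g ^ k) p ∈ Rij i j := by
  induction k generalizing i with
  | zero => simpa using hp
  | succ k ih =>
    rw [pow_succ', Module.End.mul_apply]
    exact DopL_mem_Rij (ih (by rwa [show i + 1 + k = i + (k + 1) by ring]))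

lemma X_zero_mul_mem_Rij {i j : ℕ} {p : MvPolynomial ℕ ℚ} (hp : p ∈ Rij i j) :
    X 0 * p ∈ Rij (i + 1) j := by
  suffices Rij i j ≤ (Rij (i + 1) j).comap (LinearMap.mulLeft ℚ (X 0 : MvPolynomial ℕ ℚ)) from
    this hp
  rw [Rij_eq, Rij_eq, monSpan_le]
  rintro d ⟨rfl, rfl⟩
  rw [Submodule.mem_comap, LinearMap.mulLeft_apply]
  rw [X, monomial_mul, one_mul]
  refine monomial_mem_monSpan ⟨?_, ?_⟩ <;>
    simp [codimW_add, levelW_add, codimW_single, levelW_single, add_comm]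

lemma X_zero_pow_mul_mem_Rij {i j : ℕ} (k : ℕ) {p : MvPolynomial ℕ ℚ} (hp : p ∈ Rij i j) :
    X 0 ^ k * p ∈ Rij (i + k) j := by
  induction k with
  | zero => simpa using hp
  | succ k ih =>
    rw [pow_succ', mul_assoc]
    exact X_zero_mul_mem_Rij ih

lemma DopL_X_zero_pow_mul {g i j : ℕ} (k : ℕ) {p : MvPolynomial ℕ ℚ} (hp : p ∈ Rij i j) :
    DopL g (X 0 ^ (k + 1) * p) = X 0 ^ (k + 1) * DopL g p +
      (((k : ℚ) + 1) * (2 * (i : ℚ) - j - g + k)) • (X 0 ^ k * p) := by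
  induction k with
  | zero => simpa using DopL_X_zero_mul hp
  | succ k ih =>
    rw [pow_succ', mul_assoc, DopL_X_zero_mul (X_zero_pow_mul_mem_Rij (k + 1) hp), ih, mul_add,
      mul_smul_comm, ← mul_assoc, ← mul_assoc, ← pow_succ' (X 0) k, add_assoc, ← add_smul]
    congr 2
    push_cast
    ring

/-- The coefficients of the extremal projector of `sl₂` in lowest weight `-n`. -/
def extremalCoeff (n : ℚ) (k : ℕ) : ℚ :=
  ∏ t ∈ Finset.range k, (((t : ℚ) + 1) * (n + 2 + t))⁻¹

lemma extremalCoeff_succ {n : ℚ} (hn : 0 ≤ n) (k : ℕ) :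
    extremalCoeff n (k + 1) * (((k : ℚ) + 1) * (n + 2 + k)) = extremalCoeff n k := by
  rw [extremalCoeff, Finset.prod_range_succ, ← extremalCoeff, mul_assoc, inv_mul_cancel₀, mul_one]
  positivity

/-- The image of the monomial with exponent `d` under the extremal projector; for `d 0 = 0` and
`3 * levelW d ≤ g` it is a lowest weight vector congruent to the monomial modulo `x₁`. -/
def lowestVec (g : ℕ) (d : ℕ →₀ ℕ) : MvPolynomial ℕ ℚ :=
  ∑ k ∈ Finset.range (codimW d + 1), extremalCoeff ((g : ℚ) + levelW d - 2 * codimW d) k •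
    (X 0 ^ k * (DopL g ^ k) (monomial d 1))

lemma monomial_mem_Rij (d : ℕ →₀ ℕ) : monomial d (1 : ℚ) ∈ Rij (codimW d) (levelW d) := by
  rw [Rij_eq]
  exact monomial_mem_monSpan ⟨rfl, rfl⟩

lemma lowestVec_mem (g : ℕ) (d : ℕ →₀ ℕ) : lowestVec g d ∈ Rij (codimW d) (levelW d) := by
  refine Submodule.sum_mem _ fun k hk => Submodule.smul_mem _ _ ?_
  obtain ⟨i, hi⟩ : ∃ i, codimW d = i + k := ⟨codimW d - k, by
    have := Finset.mem_range.mp hk; omega⟩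
  have h := monomial_mem_Rij d
  rw [hi] at h ⊢
  exact X_zero_pow_mul_mem_Rij k (DopL_pow_mem_Rij k h)

lemma DopL_lowestVec {g : ℕ} {d : ℕ →₀ ℕ} (h : 2 * codimW d ≤ g + levelW d) :
    DopL g (lowestVec g d) = 0 := by
  have hn : (0 : ℚ) ≤ (g : ℚ) + levelW d - 2 * codimW d := by
    have : (2 * codimW d : ℚ) ≤ g + levelW d := by exact_mod_cast h
    linarith
  have key : ∀ N ≤ codimW d, DopL g (∑ k ∈ Finset.range (N + 1),
      extremalCoeff ((g : ℚ) + levelW d - 2 * codimW d) k •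
        (X 0 ^ k * (DopL g ^ k) (monomial d 1))) =
      extremalCoeff ((g : ℚ) + levelW d - 2 * codimW d) N •
        (X 0 ^ N * (DopL g ^ (N + 1)) (monomial d 1)) := by
    intro N
    induction N with
    | zero => intro _; simp
    | succ N ih =>
      intro hN
      obtain ⟨i, hi⟩ : ∃ i, codimW d = i + (N + 1) := ⟨codimW d - (N + 1), by omega⟩
      have hm := monomial_mem_Rij d
      rw [hi] at hm
      rw [Finset.sum_range_succ, map_add, ih (by omega), map_smul,
        DopL_X_zero_pow_mul N (DopL_pow_mem_Rij (N + 1) hm), ← extremalCoeff_succ hn N,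
        pow_succ' (DopL g) (N + 1), Module.End.mul_apply, smul_add, smul_smul,
        add_comm, add_assoc, ← add_smul, hi]
      convert add_zero _ using 2
      convert zero_smul ℚ _ using 2
      push_cast
      ring
  rw [lowestVec, key _ le_rfl]
  have hm : monomial d (1 : ℚ) ∈ Rij (0 + codimW d) (levelW d) := by
    simpa using monomial_mem_Rij d
  rw [pow_succ', Module.End.mul_apply, DopL_eq_zero (DopL_pow_mem_Rij _ hm)]
  simp

lemma lowestVec_eq (g : ℕ) (d : ℕ →₀ ℕ) :
    ∃ r, lowestVec g d = monomial d 1 + X 0 * r ∧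
      ∀ i, codimW d = i + 1 → r ∈ Rij i (levelW d) := by
  refine ⟨∑ k ∈ Finset.range (codimW d),
    extremalCoeff ((g : ℚ) + levelW d - 2 * codimW d) (k + 1) •
    (X 0 ^ k * (DopL g ^ (k + 1)) (monomial d 1)), ?_, ?_⟩
  · rw [lowestVec, Finset.sum_range_succ', add_comm, Finset.mul_sum]
    congr 1
    · simp [extremalCoeff]
    · refine Finset.sum_congr rfl fun k _ => ?_
      rw [mul_smul_comm, ← mul_assoc, pow_succ' (X 0)]
  · intro i hi
    refine Submodule.sum_mem _ fun k hk => Submodule.smul_mem _ _ ?_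
    obtain ⟨l, hl⟩ : ∃ l, i = l + k := ⟨i - k, by
      have := Finset.mem_range.mp hk; omega⟩
    have h := monomial_mem_Rij d
    rw [hi, hl, add_assoc] at h
    rw [hl]
    exact X_zero_pow_mul_mem_Rij k (DopL_pow_mem_Rij (k + 1) h)

/-- The `ℚ[x₁]`-linear map sending a monomial without `x₁` to its `lowestVec`. -/
def lowestMap (g : ℕ) : MvPolynomial ℕ ℚ →ₗ[ℚ] MvPolynomial ℕ ℚ :=
  (basisMonomials ℕ ℚ).constr ℚ fun d => X 0 ^ d 0 * lowestVec g (d.erase 0)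

lemma lowestMap_monomial (g : ℕ) (d : ℕ →₀ ℕ) :
    lowestMap g (monomial d 1) = X 0 ^ d 0 * lowestVec g (d.erase 0) := by
  rw [lowestMap, show monomial d (1 : ℚ) = basisMonomials ℕ ℚ d by simp,
    Module.Basis.constr_basis]

lemma lowestMap_X_zero_mul (g : ℕ) (p : MvPolynomial ℕ ℚ) :
    lowestMap g (X 0 * p) = X 0 * lowestMap g p := by
  suffices lowestMap g ∘ₗ LinearMap.mulLeft ℚ (X 0) = LinearMap.mulLeft ℚ (X 0) ∘ₗ lowestMap g from
    LinearMap.congr_fun this p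
  refine (basisMonomials ℕ ℚ).ext fun d => ?_
  simp only [coe_basisMonomials, LinearMap.comp_apply, LinearMap.mulLeft_apply]
  rw [X, monomial_mul, one_mul, lowestMap_monomial, lowestMap_monomial, ← X]
  have : (Finsupp.single 0 1 + d).erase 0 = d.erase 0 := by
    simp [Finsupp.erase_add]
  rw [this]
  simp only [Finsupp.add_apply, Finsupp.single_eq_same]
  ring

lemma lowestMap_mem_Rij {g i j : ℕ} {p : MvPolynomial ℕ ℚ} (hp : p ∈ Rij i j) :
    lowestMap g p ∈ Rij i j := by
  suffices Rij i j ≤ (Rij i j).comap (lowestMap g) from this hp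
  nth_rw 1 [Rij_eq]
  rw [monSpan_le]
  rintro d ⟨rfl, rfl⟩
  rw [Submodule.mem_comap, lowestMap_monomial, codimW_erase, ← levelW_erase]
  exact X_zero_pow_mul_mem_Rij _ (lowestVec_mem g _)

lemma Rij_le_map_lowestMap (g i j : ℕ) : Rij i j ≤ (Rij i j).map (lowestMap g) := by
  induction i with
  | zero =>
    nth_rw 1 [Rij_eq]
    rw [monSpan_le]
    rintro d ⟨h, rfl⟩
    refine ⟨monomial d 1, h ▸ monomial_mem_Rij d, ?_⟩
    have h0 : d 0 = 0 := by have := codimW_erase d; omega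
    have h1 : d.erase 0 = d := Finsupp.erase_of_notMem_support (by simp [h0])
    rw [lowestMap_monomial, h0, h1, lowestVec, h]
    simp [extremalCoeff]
  | succ i ih =>
    nth_rw 1 [Rij_eq]
    rw [monSpan_le]
    have hX : ∀ r ∈ Rij i j, X 0 * r ∈ (Rij (i + 1) j).map (lowestMap g) := by
      intro r hr
      obtain ⟨q, hq, rfl⟩ := ih hr
      exact ⟨X 0 * q, X_zero_mul_mem_Rij hq, lowestMap_X_zero_mul g q⟩
    rintro d ⟨h, rfl⟩
    by_cases h0 : d 0 = 0
    · have h1 : d.erase 0 = d := Finsupp.erase_of_notMem_support (by simp [h0])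
      obtain ⟨r, hr, hr'⟩ := lowestVec_eq g d
      have h2 : monomial d 1 = lowestMap g (monomial d 1) - X 0 * r := by
        rw [lowestMap_monomial, h0, h1, hr]; simp
      rw [h2]
      refine Submodule.sub_mem _ ⟨_, h ▸ monomial_mem_Rij d, rfl⟩ (hX r (hr' i h))
    · obtain ⟨e, rfl⟩ : ∃ e, d = Finsupp.single 0 1 + e :=
        ⟨d - Finsupp.single 0 1, (add_tsub_cancel_of_le
          (by simpa using Nat.one_le_iff_ne_zero.mpr h0)).symm⟩
      have h2 : monomial (Finsupp.single 0 1 + e) (1 : ℚ) = X 0 * monomial e 1 := by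
        rw [X, monomial_mul, one_mul]
      rw [h2]
      refine hX _ ?_
      rw [Rij_eq]
      refine monomial_mem_monSpan ⟨?_, ?_⟩
      · simp [codimW_add, codimW_single] at h; omega
      · simp [levelW_add, levelW_single]

lemma lowestMap_surjective (g : ℕ) : Function.Surjective (lowestMap g) := by
  rw [← LinearMap.range_eq_top, eq_top_iff]
  intro p _
  rw [p.as_sum]
  refine Submodule.sum_mem _ fun d _ => ?_
  have : monomial d (coeff d p) = coeff d p • monomial d (1 : ℚ) := by simp [smul_monomial]
  rw [this]
  obtain ⟨q, -, hq⟩ := Rij_le_map_lowestMap g _ _ (monomial_mem_Rij d)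
  exact Submodule.smul_mem _ _ ⟨q, hq⟩

lemma coeff_lowestMap_monomial (g : ℕ) {d e : ℕ →₀ ℕ} (h : d 0 ≤ e 0) :
    coeff d (lowestMap g (monomial e 1)) = if e = d then 1 else 0 := by
  obtain ⟨r, hr, -⟩ := lowestVec_eq g (e.erase 0)
  have h1 : lowestMap g (monomial e 1) = monomial e 1 +
      monomial (Finsupp.single 0 (e 0 + 1)) 1 * r := by
    rw [lowestMap_monomial, hr, mul_add, ← X_pow_eq_monomial, pow_succ, mul_assoc]
    congr 1
    rw [X_pow_eq_monomial, monomial_mul, one_mul, add_comm, Finsupp.erase_add_single]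
  rw [h1, coeff_add, coeff_monomial, coeff_monomial_mul', if_neg (c := _ ≤ _), add_zero]
  intro hle
  have := hle 0
  simp at this
  omega

lemma lowestMap_injective (g : ℕ) : Function.Injective (lowestMap g) := by
  rw [injective_iff_map_eq_zero]
  intro q hq
  by_contra hne
  obtain ⟨d, hd, hmin⟩ := Finset.exists_min_image q.support (fun d => d 0)
    (support_nonempty.mpr hne)
  have h1 : coeff d (lowestMap g q) = coeff d q := by
    conv_lhs => rw [q.as_sum]
    rw [map_sum, coeff_sum, Finset.sum_eq_single d]
    · have : monomial d (coeff d q) = coeff d q • monomial d (1 : ℚ) := by simp [smul_monomial]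
      rw [this, map_smul, coeff_smul, coeff_lowestMap_monomial g le_rfl]
      simp
    · intro e he hed
      have : monomial e (coeff e q) = coeff e q • monomial e (1 : ℚ) := by simp [smul_monomial]
      rw [this, map_smul, coeff_smul, coeff_lowestMap_monomial g (hmin e he), if_neg hed, smul_zero]
    · intro h; exact absurd hd h
  rw [hq, coeff_zero] at h1
  exact (mem_support_iff.mp hd) h1.symm

/-- `lowestMap` as a linear equivalence. -/
def lowestEquiv (g : ℕ) : MvPolynomial ℕ ℚ ≃ₗ[ℚ] MvPolynomial ℕ ℚ :=
  LinearEquiv.ofBijective (lowestMap g) ⟨lowestMap_injective g, lowestMap_surjective g⟩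

lemma lowestEquiv_apply (g : ℕ) (p : MvPolynomial ℕ ℚ) : lowestEquiv g p = lowestMap g p := rfl

lemma lowestEquiv_symm_mem_Rij {g i j : ℕ} {p : MvPolynomial ℕ ℚ} (hp : p ∈ Rij i j) :
    (lowestEquiv g).symm p ∈ Rij i j := by
  obtain ⟨q, hq, rfl⟩ := Rij_le_map_lowestMap g i j hp
  rwa [← lowestEquiv_apply, LinearEquiv.symm_apply_apply]

/-- Both directions of `lowestEquiv` preserve spans of monomials that are cut out by conditions on
the codimension and the level. -/
lemma lowestEquiv_symm_mem_monSpan {g : ℕ} {P : ℕ → ℕ → Prop} {p : MvPolynomial ℕ ℚ}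
    (hp : p ∈ monSpan {d | P (codimW d) (levelW d)}) :
    (lowestEquiv g).symm p ∈ monSpan {d | P (codimW d) (levelW d)} := by
  suffices monSpan {d | P (codimW d) (levelW d)} ≤
    (monSpan {d | P (codimW d) (levelW d)}).comap (lowestEquiv g).symm.toLinearMap from this hp
  rw [monSpan_le]
  intro d hd
  have := lowestEquiv_symm_mem_Rij (g := g) (monomial_mem_Rij d)
  rw [Rij_eq] at this
  refine monSpan_mono ?_ this
  rintro e ⟨h1, h2⟩
  simpa [h1, h2] using hd

lemma lowestMap_mem_monSpan {g : ℕ} {P : ℕ → ℕ → Prop} {p : MvPolynomial ℕ ℚ}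
    (hp : p ∈ monSpan {d | P (codimW d) (levelW d)}) :
    lowestMap g p ∈ monSpan {d | P (codimW d) (levelW d)} := by
  suffices monSpan {d | P (codimW d) (levelW d)} ≤
    (monSpan {d | P (codimW d) (levelW d)}).comap (lowestMap g) from this hp
  rw [monSpan_le]
  intro d hd
  have := lowestMap_mem_Rij (g := g) (monomial_mem_Rij d)
  rw [Rij_eq] at this
  refine monSpan_mono ?_ this
  rintro e ⟨h1, h2⟩
  simpa [h1, h2] using hd

lemma lowestEquiv_symm_mem_Rlev {g j : ℕ} {p : MvPolynomial ℕ ℚ} (hp : p ∈ Rlev j) :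
    (lowestEquiv g).symm p ∈ Rlev j := by
  rw [Rlev_eq] at hp ⊢
  exact lowestEquiv_symm_mem_monSpan (P := fun _ l => l = j) hp

lemma lowestMap_mem_Rlev {g j : ℕ} {p : MvPolynomial ℕ ℚ} (hp : p ∈ Rlev j) :
    lowestMap g p ∈ Rlev j := by
  rw [Rlev_eq] at hp ⊢
  exact lowestMap_mem_monSpan (P := fun _ l => l = j) hp

lemma DopL_lowestMap_monomial_of_zero {g : ℕ} {d : ℕ →₀ ℕ} (hd : 3 * levelW d ≤ g)
    (h0 : d 0 = 0) : DopL g (lowestMap g (monomial d 1)) = 0 := by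
  rw [lowestMap_monomial, h0, pow_zero, one_mul]
  refine DopL_lowestVec ?_
  have := codimW_le_two_mul_levelW (d := d.erase 0) (by simp)
  rw [levelW_erase] at *
  omega

lemma DopL_lowestMap_monomial {g : ℕ} {d : ℕ →₀ ℕ} (hd : 3 * levelW d ≤ g) :
    DopL g (lowestMap g (monomial (d + Finsupp.single 0 1) 1)) =
      (((d 0 : ℚ) + 1) * (2 * (codimW d : ℚ) - levelW d - g - d 0)) •
        lowestMap g (monomial d 1) := by
  have hz : DopL g (lowestVec g (d.erase 0)) = 0 := by
    refine DopL_lowestVec ?_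
    have := codimW_le_two_mul_levelW (d := d.erase 0) (by simp)
    rw [levelW_erase] at *
    omega
  have he : (d + Finsupp.single 0 1).erase 0 = d.erase 0 := by simp [Finsupp.erase_add]
  rw [lowestMap_monomial, lowestMap_monomial, he]
  simp only [Finsupp.add_apply, Finsupp.single_eq_same]
  rw [DopL_X_zero_pow_mul (d 0) (lowestVec_mem g _), hz, mul_zero, zero_add, levelW_erase,
    codimW_erase d]
  congr 1
  push_cast
  ring

/-- The exponents without `x₁` of codimension `i` and level `j` correspond to the partitions of `j`
into `i - j` parts. -/
def partitionEquiv {i j : ℕ} (hij : j ≤ i) :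
    { p : Nat.Partition j // p.parts.card = i - j } ≃
      { d : ℕ →₀ ℕ // d 0 = 0 ∧ codimW d = i ∧ levelW d = j } where
  toFun p := ⟨Multiset.toFinsupp p.1.parts, by
    have hl : ∀ s : Multiset ℕ, levelW (Multiset.toFinsupp s) = s.sum := fun s => by
      induction s using Multiset.induction with
      | empty => simp [levelW]
      | cons a s ih =>
        rw [← Multiset.singleton_add, map_add, levelW_add, ih, Multiset.toFinsupp_singleton,
          levelW_single]
        simp
    have hc : ∀ s : Multiset ℕ, codimW (Multiset.toFinsupp s) = s.sum + s.card := fun s => by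
      induction s using Multiset.induction with
      | empty => simp [codimW]
      | cons a s ih =>
        rw [← Multiset.singleton_add, map_add, codimW_add, ih, Multiset.toFinsupp_singleton,
          codimW_single]
        simp
        ring
    have hs := p.1.parts_sum
    have hp := p.2
    refine ⟨?_, ?_, ?_⟩
    · rw [Multiset.toFinsupp_apply, Multiset.count_eq_zero]
      exact fun h => lt_irrefl _ (p.1.parts_pos h)
    · rw [hc, hs, hp]; omega
    · rw [hl, hs]⟩
  invFun d := ⟨⟨Finsupp.toMultiset d.1, fun {v} hv => by
      rw [Finsupp.mem_toMultiset, Finsupp.mem_support_iff] at hv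
      refine Nat.pos_of_ne_zero ?_
      rintro rfl
      exact hv d.2.1, by
      rw [Finsupp.toMultiset_apply, Finsupp.sum, Multiset.sum_sum]
      refine Eq.trans (Finset.sum_congr rfl fun v _ => ?_) d.2.2.2
      rw [Multiset.sum_nsmul, Multiset.sum_singleton, smul_eq_mul, mul_comm]⟩, by
    have h : codimW d.1 = levelW d.1 + (Finsupp.toMultiset d.1).card := by
      rw [Finsupp.card_toMultiset, codimW, levelW, Finsupp.sum, Finsupp.sum, Finsupp.sum,
        ← Finset.sum_add_distrib]
      exact Finset.sum_congr rfl fun v _ => by simp; ring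
    have := d.2.2
    change (Finsupp.toMultiset d.1).card = _
    omega⟩
  left_inv p := by
    ext1
    ext1
    exact Multiset.toFinsupp_toMultiset _
  right_inv d := by
    ext1
    exact Finsupp.toMultiset_toFinsupp _

/-- An enumeration of the exponents without `x₁` of codimension `i` and level `j`. -/
def exponentEquiv {i j : ℕ} (hij : j ≤ i) :
    Fin (nuIJ i j) ≃ { d : ℕ →₀ ℕ // d 0 = 0 ∧ codimW d = i ∧ levelW d = j } :=
  (Fintype.equivFin _).symm.trans (partitionEquiv hij)

/-- The index set of the standard basis of `Tspace5 g j`. -/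
abbrev TIndex (g j : ℕ) : Type :=
  (i : Finset.Icc (j + 1) (2 * j)) × Fin (nuIJ (i : ℕ) j) × Fin (g + j - 2 * (i : ℕ) + 1)

lemma le_of_mem_Icc_succ {j : ℕ} (i : Finset.Icc (j + 1) (2 * j)) : j ≤ (i : ℕ) := by
  have := Finset.mem_Icc.mp i.2
  omega

/-- The exponent of the monomial corresponding to a standard basis vector of `Tspace5 g j`. -/
def tExponent (g j : ℕ) (x : TIndex g j) : ℕ →₀ ℕ :=
  (exponentEquiv (le_of_mem_Icc_succ x.1) x.2.1).1 +
    Finsupp.single 0 (g + j - 2 * (x.1 : ℕ) - (x.2.2 : ℕ))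

lemma tExponent_zero (g j : ℕ) (x : TIndex g j) :
    tExponent g j x 0 = g + j - 2 * (x.1 : ℕ) - (x.2.2 : ℕ) := by
  have := (exponentEquiv (le_of_mem_Icc_succ x.1) x.2.1).2.1
  simp [tExponent, this]

lemma tExponent_erase (g j : ℕ) (x : TIndex g j) :
    (tExponent g j x).erase 0 = (exponentEquiv (le_of_mem_Icc_succ x.1) x.2.1).1 := by
  have := (exponentEquiv (le_of_mem_Icc_succ x.1) x.2.1).2.1
  rw [tExponent, Finsupp.erase_add, Finsupp.erase_single, add_zero]
  exact Finsupp.erase_of_notMem_support (by simp [this])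

lemma levelW_tExponent (g j : ℕ) (x : TIndex g j) : levelW (tExponent g j x) = j := by
  rw [← levelW_erase, tExponent_erase]
  exact (exponentEquiv (le_of_mem_Icc_succ x.1) x.2.1).2.2.2

lemma codimW_tExponent (g j : ℕ) (x : TIndex g j) :
    codimW (tExponent g j x) = x.1 + (g + j - 2 * (x.1 : ℕ) - (x.2.2 : ℕ)) := by
  rw [codimW_erase, tExponent_zero, tExponent_erase,
    (exponentEquiv (le_of_mem_Icc_succ x.1) x.2.1).2.2.1]

lemma tExponent_injective (g j : ℕ) : Function.Injective (tExponent g j) := by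
  rintro ⟨i, m, k⟩ ⟨i', m', k'⟩ h
  have h1 : i = i' := by
    have h0 := congrArg (fun d => d 0) h
    have hc := congrArg codimW h
    simp only [tExponent_zero] at h0
    rw [codimW_tExponent, codimW_tExponent] at hc
    ext
    dsimp only at *
    omega
  subst h1
  have h2 : m = m' := by
    have he := congrArg (Finsupp.erase 0) h
    rw [tExponent_erase, tExponent_erase] at he
    exact (exponentEquiv (le_of_mem_Icc_succ i)).injective (Subtype.ext he)
  subst h2
  have h3 : k = k' := by
    have h0 := congrArg (fun d => d 0) h
    simp only [tExponent_zero] at h0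
    have hk := k.2
    have hk' := k'.2
    ext
    omega
  rw [h3]

lemma exists_tExponent_eq {g j : ℕ} (hj : 0 < j) {d : ℕ →₀ ℕ} (hd : levelW d = j)
    (h : 2 * codimW d ≤ g + j + d 0) : ∃ x, tExponent g j x = d := by
  have hc := codimW_erase d
  have hl := levelW_lt_codimW (d := d) (by omega)
  have hu := codimW_le_of_levelW d
  let i : Finset.Icc (j + 1) (2 * j) :=
    ⟨codimW (d.erase 0), Finset.mem_Icc.mpr ⟨by omega, by omega⟩⟩
  refine ⟨⟨i, (exponentEquiv (le_of_mem_Icc_succ i)).symm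
    ⟨d.erase 0, by simp, rfl, by rw [levelW_erase, hd]⟩,
    ⟨g + j - 2 * codimW (d.erase 0) - d 0, by dsimp only [i]; omega⟩⟩, ?_⟩
  rw [tExponent]
  simp only [Equiv.apply_symm_apply]
  conv_rhs => rw [← Finsupp.erase_add_single 0 d]
  congr 2
  dsimp only [i]
  omega

/-- The exponents of level `j` whose basis vectors span the relations of level `j`, together with
all exponents of level different from `j`. -/
def relExponents (g j : ℕ) : Set (ℕ →₀ ℕ) :=
  {d | levelW d = j → g + j + d 0 < 2 * codimW d}

lemma DopL_mem_relations {g j : ℕ} (hjg : 3 * j ≤ g) {p : MvPolynomial ℕ ℚ}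
    (hp : (lowestEquiv g).symm p ∈ monSpan (relExponents g j)) :
    (lowestEquiv g).symm (DopL g p) ∈ monSpan (relExponents g j) := by
  obtain ⟨q, rfl⟩ := (lowestEquiv g).surjective p
  rw [LinearEquiv.symm_apply_apply] at hp
  suffices monSpan (relExponents g j) ≤ (monSpan (relExponents g j)).comap
    ((lowestEquiv g).symm.toLinearMap ∘ₗ DopL g ∘ₗ (lowestEquiv g).toLinearMap) from this hp
  rw [monSpan_le]
  intro d hd
  change (lowestEquiv g).symm (DopL g (lowestMap g (monomial d 1))) ∈ monSpan (relExponents g j)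
  by_cases hl : levelW d = j
  · by_cases h0 : d 0 = 0
    · rw [DopL_lowestMap_monomial_of_zero (by omega) h0, map_zero]
      exact Submodule.zero_mem _
    · obtain ⟨e, rfl⟩ : ∃ e, d = e + Finsupp.single 0 1 :=
        ⟨d - Finsupp.single 0 1, (tsub_add_cancel_of_le
          (by simpa using Nat.one_le_iff_ne_zero.mpr h0)).symm⟩
      have hd' := hd hl
      simp only [levelW_add, levelW_single, codimW_add, codimW_single, Finsupp.add_apply,
        Finsupp.single_eq_same] at hl hd'
      rw [DopL_lowestMap_monomial (by omega), map_smul, ← lowestEquiv_apply,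
        LinearEquiv.symm_apply_apply]
      by_cases he : g + j + e 0 < 2 * codimW e
      · exact Submodule.smul_mem _ _ (monomial_mem_monSpan fun _ => he)
      · have hq : (2 * codimW e : ℚ) = g + j + e 0 := by
          have : 2 * codimW e = g + j + e 0 := by omega
          exact_mod_cast this
        have hlq : (levelW e : ℚ) = j := by
          have : levelW e = j := by omega
          exact_mod_cast this
        convert Submodule.zero_mem _
        convert zero_smul ℚ _ using 2
        rw [hq, hlq]
        ring
  · have h1 : monomial d (1 : ℚ) ∈ Rlev (levelW d) := by
      rw [Rlev_eq]; exact monomial_mem_monSpan rfl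
    have h2 := lowestEquiv_symm_mem_Rlev (g := g) (DopL_mem_Rlev (g := g)
      (lowestMap_mem_Rlev (g := g) h1))
    rw [Rlev_eq] at h2
    refine monSpan_mono ?_ h2
    intro e he hej
    exact absurd (he.symm.trans hej) hl

lemma Ipol_le_relations {g j : ℕ} (hj : 0 < j) (hjg : 3 * j ≤ g) :
    Ipol g ≤ (monSpan (relExponents g j)).comap (lowestEquiv g).symm.toLinearMap := by
  refine sup_le ?_ (iSup_le fun n => ?_)
  · intro p hp
    rw [Rgt_eq] at hp
    refine monSpan_mono ?_ (lowestEquiv_symm_mem_monSpan (g := g) (P := fun c _ => g < c) hp)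
    intro d hd hl
    have := levelW_lt_codimW (d := d) (by omega)
    simp only [Set.mem_ofPred_eq] at hd
    omega
  · rw [Submodule.span_le]
    rintro _ ⟨p, hp, rfl⟩
    have h0 : (lowestEquiv g).symm p ∈ monSpan (relExponents g j) := by
      rw [SetLike.mem_coe, Fil1Rg_eq] at hp
      refine monSpan_mono ?_
        (lowestEquiv_symm_mem_monSpan (g := g) (P := fun c l => c = g ∧ 1 ≤ l) hp)
      rintro d ⟨hd, -⟩ hl
      have := levelW_lt_codimW (d := d) (by omega)
      omega
    change (lowestEquiv g).symm ((Dop g)^[n] p) ∈ monSpan (relExponents g j)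
    clear hp
    induction n generalizing p with
    | zero => exact h0
    | succ n ih => exact ih _ (DopL_mem_relations hjg h0)

lemma lowestMap_monomial_mem_Ipol {g j : ℕ} (hj : 0 < j) (hjg : 3 * j ≤ g) {d : ℕ →₀ ℕ}
    (hl : levelW d = j) (hd : g + j + d 0 < 2 * codimW d) :
    lowestMap g (monomial d 1) ∈ Ipol g := by
  by_cases hg : g < codimW d
  · refine Submodule.mem_sup_left ?_
    rw [Rgt_eq]
    exact lowestMap_mem_monSpan (P := fun c _ => g < c) (monomial_mem_monSpan hg)
  refine Submodule.mem_sup_right ?_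
  set J := ⨆ n : ℕ, Submodule.span ℚ ((Dop g)^[n] '' (Fil1Rg g : Set (MvPolynomial ℕ ℚ)))
  have hDJ : J ≤ J.comap (DopL g) := by
    refine iSup_le fun n => ?_
    rw [Submodule.span_le]
    rintro _ ⟨p, hp, rfl⟩
    refine Submodule.mem_iSup_of_mem (n + 1) (Submodule.subset_span ⟨p, hp, ?_⟩)
    rw [Function.iterate_succ_apply', DopL_apply]
  obtain ⟨t, ht⟩ : ∃ t, codimW d + t = g := ⟨g - codimW d, by omega⟩
  clear hg
  induction t generalizing d with
  | zero =>
    refine Submodule.mem_iSup_of_mem 0 (Submodule.subset_span ⟨_, ?_, rfl⟩)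
    rw [SetLike.mem_coe, Fil1Rg_eq]
    exact lowestMap_mem_monSpan (P := fun c l => c = g ∧ 1 ≤ l)
      (monomial_mem_monSpan ⟨by omega, by omega⟩)
  | succ t ih =>
    have h1 := hDJ (ih (d := d + Finsupp.single 0 1)
      (by simp [levelW_add, levelW_single, hl])
      (by simp [codimW_add, codimW_single]; omega)
      (by simp [codimW_add, codimW_single]; omega))
    rw [Submodule.mem_comap, DopL_lowestMap_monomial (by omega)] at h1
    refine (Submodule.smul_mem_iff _ ?_).mp h1
    have hq : (g : ℚ) + j + d 0 < 2 * codimW d := by exact_mod_cast hd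
    rw [hl]
    have : (0 : ℚ) < 2 * (codimW d : ℚ) - j - g - d 0 := by linarith
    positivity

/-- The coordinates of a polynomial with respect to the images of the monomials under
`lowestMap`, rescaled so as to match the standard basis of `Tspace5 g j`. -/
def toTspace (g j : ℕ) : MvPolynomial ℕ ℚ →ₗ[ℚ] Tspace5 g j where
  toFun p := fun i m k => ((g + j - 2 * (i : ℕ) - (k : ℕ)).factorial : ℚ) *
    coeff (tExponent g j ⟨i, m, k⟩) ((lowestEquiv g).symm p)
  map_add' p q := by
    funext i m k
    change (_ : ℚ) = _ * _ + _ * _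
    rw [map_add, coeff_add, mul_add]
  map_smul' c p := by
    funext i m k
    change (_ : ℚ) = c * (_ * _)
    rw [map_smul, coeff_smul, smul_eq_mul]
    ring

lemma toTspace_apply (g j : ℕ) (p : MvPolynomial ℕ ℚ) (i : Finset.Icc (j + 1) (2 * j))
    (m : Fin (nuIJ (i : ℕ) j)) (k : Fin (g + j - 2 * (i : ℕ) + 1)) :
    toTspace g j p i m k = ((g + j - 2 * (i : ℕ) - (k : ℕ)).factorial : ℚ) *
      coeff (tExponent g j ⟨i, m, k⟩) ((lowestEquiv g).symm p) := rfl

lemma map_toTspace_Rlev (g j : ℕ) : Submodule.map (toTspace g j) (Rlev j) = ⊤ := by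
  rw [eq_top_iff]
  intro v _
  let c : TIndex g j → ℚ := fun x =>
    ((g + j - 2 * (x.1 : ℕ) - (x.2.2 : ℕ)).factorial : ℚ)⁻¹ * v x.1 x.2.1 x.2.2
  let q : MvPolynomial ℕ ℚ := ∑ x, c x • monomial (tExponent g j x) 1
  have hq : q ∈ Rlev j := by
    refine Submodule.sum_mem _ fun x _ => Submodule.smul_mem _ _ ?_
    rw [Rlev_eq]
    exact monomial_mem_monSpan (levelW_tExponent g j x)
  have hcoeff : ∀ x, coeff (tExponent g j x) q = c x := by
    intro x
    rw [coeff_sum, Finset.sum_eq_single x]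
    · simp
    · intro y _ hy
      rw [coeff_smul, coeff_monomial, if_neg fun h => hy (tExponent_injective g j h), smul_zero]
    · simp
  refine ⟨lowestMap g q, lowestMap_mem_Rlev hq, ?_⟩
  funext i m k
  rw [toTspace_apply, ← lowestEquiv_apply, LinearEquiv.symm_apply_apply, hcoeff,
    mul_inv_cancel_left₀ (by positivity)]

lemma toTspace_eq_zero_iff {g j : ℕ} (hj : 0 < j) (hjg : 3 * j ≤ g) {p : MvPolynomial ℕ ℚ}
    (hp : p ∈ Rlev j) : toTspace g j p = 0 ↔ p ∈ Ipol g := by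
  constructor
  · intro h
    have hlev := lowestEquiv_symm_mem_Rlev (g := g) hp
    rw [Rlev_eq] at hlev
    obtain ⟨q, rfl⟩ := (lowestEquiv g).surjective p
    rw [LinearEquiv.symm_apply_apply] at hlev
    suffices hq : q ∈ monSpan {d | levelW d = j ∧ g + j + d 0 < 2 * codimW d} by
      suffices monSpan {d | levelW d = j ∧ g + j + d 0 < 2 * codimW d} ≤
        (Ipol g).comap (lowestMap g) from this hq
      rw [monSpan_le]
      rintro d ⟨hl, hd⟩
      exact lowestMap_monomial_mem_Ipol hj hjg hl hd
    rw [mem_monSpan] at hlev ⊢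
    intro d hd
    refine ⟨hlev d hd, ?_⟩
    by_contra hlt
    obtain ⟨⟨i, m, k⟩, rfl⟩ := exists_tExponent_eq hj (hlev d hd) (not_lt.mp hlt)
    have h0 : toTspace g j (lowestEquiv g q) i m k = 0 := by rw [h]; rfl
    rw [toTspace_apply, LinearEquiv.symm_apply_apply] at h0
    exact (mul_ne_zero (by positivity) hd) h0
  · intro h
    have hrel := mem_monSpan.mp (Ipol_le_relations hj hjg h)
    funext i m k
    rw [toTspace_apply]
    change _ = (0 : ℚ)
    refine mul_eq_zero_of_right _ ?_
    by_contra hc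
    have h1 := hrel _ hc (levelW_tExponent g j _)
    rw [tExponent_zero, codimW_tExponent] at h1
    have hi := Finset.mem_Icc.mp i.2
    dsimp only at h1
    omega

lemma tExponent_eq_add_single {g j : ℕ} {i : Finset.Icc (j + 1) (2 * j)}
    {m : Fin (nuIJ (i : ℕ) j)} {k : ℕ} (hk : k + 1 < g + j - 2 * (i : ℕ) + 1) :
    tExponent g j ⟨i, m, ⟨k, by omega⟩⟩ =
      tExponent g j ⟨i, m, ⟨k + 1, hk⟩⟩ + Finsupp.single 0 1 := by
  rw [tExponent, tExponent, add_assoc, ← Finsupp.single_add]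
  congr 2
  dsimp only
  omega

lemma lowestEquiv_symm_X_zero_mul (g : ℕ) (p : MvPolynomial ℕ ℚ) :
    (lowestEquiv g).symm (X 0 * p) = X 0 * (lowestEquiv g).symm p := by
  rw [LinearEquiv.symm_apply_eq, lowestEquiv_apply, lowestMap_X_zero_mul, ← lowestEquiv_apply,
    LinearEquiv.apply_symm_apply]

lemma toTspace_X_zero_mul (g j : ℕ) (p : MvPolynomial ℕ ℚ) :
    toTspace g j (X 0 * p) = eT5 g j (toTspace g j p) := by
  funext i m k
  rw [toTspace_apply, eT5, eV, lowestEquiv_symm_X_zero_mul]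
  obtain ⟨k, hk⟩ := k
  dsimp only
  split_ifs with h
  · rw [toTspace_apply, tExponent_eq_add_single h, add_comm (tExponent g j _), coeff_X_mul,
      ← mul_assoc]
    congr 1
    dsimp only
    obtain ⟨n, hn⟩ : ∃ n, g + j - 2 * (i : ℕ) = n + (k + 1) :=
      ⟨g + j - 2 * (i : ℕ) - (k + 1), by omega⟩
    rw [hn, show n + (k + 1) - k = n + 1 by omega, show n + (k + 1) - (k + 1) = n by omega,
      Nat.factorial_succ]
    push_cast
    ring
  · rw [coeff_X_mul', if_neg, mul_zero]
    rw [Finsupp.mem_support_iff, tExponent_zero]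
    dsimp only
    omega

lemma toTspace_DopL {g j : ℕ} (hjg : 3 * j ≤ g) {p : MvPolynomial ℕ ℚ} (hp : p ∈ Rlev j) :
    toTspace g j (DopL g p) = -fT5 g j (toTspace g j p) := by
  have hlev := lowestEquiv_symm_mem_Rlev (g := g) hp
  rw [Rlev_eq] at hlev
  obtain ⟨q, rfl⟩ := (lowestEquiv g).surjective p
  rw [LinearEquiv.symm_apply_apply] at hlev
  clear hp
  funext i m k
  obtain ⟨k, hk⟩ := k
  change _ = -((k : ℚ) * toTspace g j (lowestEquiv g q) i m ⟨k - 1, _⟩)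
  have hi := Finset.mem_Icc.mp i.2
  rw [toTspace_apply, toTspace_apply, LinearEquiv.symm_apply_apply]
  dsimp only
  induction hlev using Submodule.span_induction with
  | zero => simp
  | add x y _ _ hx hy =>
    simp only [map_add, coeff_add, mul_add, hx, hy]
    ring
  | smul c x _ hx =>
    simp only [map_smul, coeff_smul, smul_eq_mul, mul_left_comm _ c, hx]
    ring
  | mem x hx =>
    obtain ⟨d, hd, rfl⟩ := hx
    replace hd : levelW d = j := hd
    dsimp only
    rw [lowestEquiv_apply]
    by_cases h0 : d 0 = 0
    · rw [DopL_lowestMap_monomial_of_zero (by omega) h0, map_zero, coeff_zero, mul_zero]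
      rcases Nat.eq_zero_or_pos k with rfl | hkpos
      · simp
      · rw [coeff_monomial, if_neg, mul_zero, mul_zero, neg_zero]
        rintro rfl
        rw [tExponent_zero] at h0
        dsimp only at h0
        omega
    · obtain ⟨e, rfl⟩ : ∃ e, d = e + Finsupp.single 0 1 :=
        ⟨d - Finsupp.single 0 1, (tsub_add_cancel_of_le
          (by simpa using Nat.one_le_iff_ne_zero.mpr h0)).symm⟩
      have he : levelW e = j := by
        simpa [levelW_add, levelW_single] using hd
      rw [DopL_lowestMap_monomial (by omega), map_smul, ← lowestEquiv_apply,
        LinearEquiv.symm_apply_apply, coeff_smul, coeff_monomial, smul_eq_mul]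
      rcases Nat.eq_zero_or_pos k with rfl | hkpos
      · split_ifs with h
        · have h1 := codimW_tExponent g j ⟨i, m, ⟨0, hk⟩⟩
          have h2 := tExponent_zero g j ⟨i, m, ⟨0, hk⟩⟩
          rw [← h] at h1 h2
          dsimp only at h1 h2
          have h3 : 2 * codimW e = j + g + e 0 := by omega
          have h3' : (2 * codimW e : ℚ) = j + g + e 0 := by exact_mod_cast h3
          rw [he, h3']
          push_cast
          ring
        · simp
      · obtain ⟨k, rfl⟩ : ∃ l, k = l + 1 := ⟨k - 1, by omega⟩
        have hE := tExponent_eq_add_single (m := m) hk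
        rw [coeff_monomial]
        simp only [Nat.add_sub_cancel]
        rw [hE]
        simp only [add_left_inj]
        split_ifs with h
        · have h1 := codimW_tExponent g j ⟨i, m, ⟨k + 1, hk⟩⟩
          have h2 := tExponent_zero g j ⟨i, m, ⟨k + 1, hk⟩⟩
          rw [← h] at h1 h2
          dsimp only at h1 h2
          have h3 : 2 * codimW e + (k + 1) = j + g + e 0 := by omega
          have h3' : (2 * codimW e + (k + 1) : ℚ) = j + g + e 0 := by exact_mod_cast h3
          rw [he, ← h2, show g + j - 2 * (i : ℕ) - k = e 0 + 1 by omega, Nat.factorial_succ,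
            eq_sub_of_add_eq h3']
          push_cast
          ring
        · simp

lemma hT5_toTspace {g i j : ℕ} (hjg : 3 * j ≤ g) {p : MvPolynomial ℕ ℚ} (hp : p ∈ Rij i j) :
    hT5 g j (toTspace g j p) = (2 * (i : ℚ) - j - g) • toTspace g j p := by
  have hsymm := lowestEquiv_symm_mem_Rij (g := g) hp
  rw [Rij_eq, mem_monSpan] at hsymm
  funext l m k
  change (((g + j - 2 * (l : ℕ) : ℕ) : ℚ) - 2 * (k : ℕ)) * toTspace g j p l m k =
    (2 * (i : ℚ) - j - g) * toTspace g j p l m k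
  rw [toTspace_apply]
  by_cases hc : coeff (tExponent g j ⟨l, m, k⟩) ((lowestEquiv g).symm p) = 0
  · simp [hc]
  · have h1 := (hsymm _ hc).1
    rw [codimW_tExponent] at h1
    have hl := Finset.mem_Icc.mp l.2
    have hk := k.2
    dsimp only at h1
    congr 1
    rw [Nat.cast_sub (by omega)]
    have h2 : g + j = i + l + k := by omega
    have h2' : (g + j : ℚ) = i + l + k := by exact_mod_cast h2
    push_cast
    linarith

lemma Ipol_inf_Rij {g i j : ℕ} (hj : 0 < j) (hjg : 3 * j ≤ g) (hi : 2 * i ≤ g + j) :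
    Ipol g ⊓ Rij i j = ⊥ := by
  rw [eq_bot_iff]
  rintro p ⟨hI, hR⟩
  have hrel := mem_monSpan.mp (Ipol_le_relations hj hjg hI)
  have hsymm := lowestEquiv_symm_mem_Rij (g := g) hR
  rw [Rij_eq, mem_monSpan] at hsymm
  rw [Submodule.mem_bot, ← (lowestEquiv g).symm.map_eq_zero_iff]
  ext d
  by_contra hc
  rw [coeff_zero] at hc
  obtain ⟨h1, h2⟩ := hsymm d hc
  have := hrel d hc h2
  omega

/-- suppose `0 < j ≤ g/3` (i.e. `3j ≤ g`).  Then `I ∩ R^i_{(j)} = 0`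
for every `i` with `2i − j ≤ g`, and `𝓡_{(j)} ≅ ⊕_{i=j+1}^{2j} V(g−2i+j)^{⊕ν(i,j)}`
as sl₂-modules.  The isomorphism is phrased as the existence of a ℚ-linear map `Φ` on
`R` which, restricted to `R_{(j)}`, is surjective onto the target and has kernel
exactly `I ∩ R_{(j)}` (so it induces a linear isomorphism `𝓡_{(j)} ≅ T`), and which
intertwines the sl₂-actions: `e = x₁·(−)`, `f = −𝒟`, and `h` acting on `R^i_{(j)}` by
the scalar `2i − j − g`. -/
theorem stmt5 (g : ℕ) (hg : 3 ≤ g) (j : ℕ) (hj : 0 < j) (hjg : 3 * j ≤ g) :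
    (∀ i : ℕ, 2 * i ≤ g + j → Ipol g ⊓ Rij i j = ⊥) ∧
    ∃ Φ : MvPolynomial ℕ ℚ →ₗ[ℚ] Tspace5 g j,
      Submodule.map Φ (Rlev j) = ⊤ ∧
      (∀ α ∈ Rlev j, Φ α = 0 ↔ α ∈ Ipol g) ∧
      (∀ α ∈ Rlev j, Φ (X 0 * α) = eT5 g j (Φ α)) ∧
      (∀ α ∈ Rlev j, Φ (Dop g α) = - fT5 g j (Φ α)) ∧
      (∀ i : ℕ, ∀ α ∈ Rij i j, hT5 g j (Φ α) = (2 * (i : ℚ) - j - g) • Φ α) := by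
  refine ⟨fun i hi => Ipol_inf_Rij hj hjg hi, toTspace g j, map_toTspace_Rlev g j,
    fun α hα => toTspace_eq_zero_iff hj hjg hα, fun α _ => toTspace_X_zero_mul g j α,
    fun α hα => toTspace_DopL hjg hα, fun i α hα => hT5_toTspace hjg hα⟩
end
end

section
/- If g ≥ 9, then every element of R of level g − 4 lies in I; that is, 𝓡^i_{(g−4)} = 0 for all i. -/
/- We model `R = ℚ[x₁, x₂, …]` as `MvPolynomial ℕ ℚ`, the variable of index `v`
representing `x_{v+1}` (so `x_k = X (k-1)` for `k ≥ 1`). -/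

open MvPolynomial

noncomputable section

namespace Polishchuk

/-- The binomial coefficient `binom(a+b+2, b+1)` of `𝒟`. -/
abbrev coef (a b : ℕ) : ℚ := ((a + b + 2).choose (b + 1) : ℚ)

lemma coef_comm (a b : ℕ) : coef a b = coef b a := by
  unfold coef
  rw [add_comm b a, ← Nat.choose_symm_of_eq_add (show a + b + 2 = (b + 1) + (a + 1) by ring)]

lemma coef_pos (a b : ℕ) : 0 < coef a b := by
  unfold coef
  exact_mod_cast Nat.choose_pos (by omega)

lemma coef_zero_left (b : ℕ) : coef 0 b = b + 2 := by
  unfold coef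
  rw [Nat.choose_symm_of_eq_add (show 0 + b + 2 = (b + 1) + 1 by ring), Nat.choose_one_right]
  push_cast
  ring

lemma coef_mul_factorial (a b : ℕ) :
    coef a b * (a + 1).factorial * (b + 1).factorial = (a + b + 2).factorial := by
  have h := Nat.add_choose_mul_factorial_mul_factorial (a + 1) (b + 1)
  rw [show a + 1 + (b + 1) = a + b + 2 by ring] at h
  unfold coef
  exact_mod_cast h

/-- The operator `𝒟` with the second-order sum cut off at `N`. -/
def dopCut (g N : ℕ) (p : MvPolynomial ℕ ℚ) : MvPolynomial ℕ ℚ :=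
  -(g : ℚ) • pderiv 0 p +
    (1/2 : ℚ) • ∑ a ∈ Finset.range N, ∑ b ∈ Finset.range N,
      coef a b • (X (a + b) * pderiv a (pderiv b p))

lemma pderiv_comm (a b : ℕ) (p : MvPolynomial ℕ ℚ) :
    pderiv a (pderiv b p) = pderiv b (pderiv a p) := by
  have h : ⁅pderiv (R := ℚ) a, pderiv (R := ℚ) b⁆ = 0 := by
    refine MvPolynomial.derivation_ext fun i => ?_
    simp [Derivation.commutator_apply, pderiv_X, Pi.single_apply, apply_ite]
  have := congrArg (fun D => D p) h
  simpa [Derivation.commutator_apply, sub_eq_zero] using this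

lemma dop_eq_dopCut (g : ℕ) {N : ℕ} {p : MvPolynomial ℕ ℚ} (h : p.vars.sup id < N) :
    Dop g p = dopCut g N p := by
  unfold Dop dopCut
  have hz : ∀ b, b ∉ Finset.range (p.vars.sup id + 1) → pderiv b p = 0 := fun b hb =>
    pderiv_eq_zero_of_notMem_vars fun hv => hb <| Finset.mem_range.2 <|
      Nat.lt_succ_of_le (Finset.le_sup (f := id) hv)
  have hs : Finset.range (p.vars.sup id + 1) ⊆ Finset.range N := Finset.range_mono h
  congr 2
  rw [Finset.sum_subset hs]
  · refine Finset.sum_congr rfl fun a _ => Finset.sum_subset hs fun b _ hb => ?_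
    simp [hz b hb]
  · intro a _ ha
    refine Finset.sum_eq_zero fun b _ => ?_
    rw [pderiv_comm, hz a ha]
    simp

lemma dop_add (g : ℕ) (p q : MvPolynomial ℕ ℚ) : Dop g (p + q) = Dop g p + Dop g q := by
  set N := p.vars.sup id + q.vars.sup id + (p + q).vars.sup id + 1
  rw [dop_eq_dopCut g (N := N) (by omega), dop_eq_dopCut g (p := p) (N := N) (by omega),
    dop_eq_dopCut g (p := q) (N := N) (by omega)]
  simp only [dopCut, map_add, mul_add, smul_add, Finset.sum_add_distrib]
  abel

lemma dop_smul (g : ℕ) (c : ℚ) (p : MvPolynomial ℕ ℚ) : Dop g (c • p) = c • Dop g p := by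
  set N := p.vars.sup id + (c • p).vars.sup id + 1
  rw [dop_eq_dopCut g (N := N) (by omega), dop_eq_dopCut g (p := p) (N := N) (by omega)]
  simp only [dopCut, Derivation.map_smul, mul_smul_comm, smul_add, Finset.smul_sum]
  simp only [smul_comm c]

/-- `𝒟` as a linear map. -/
def dopLin (g : ℕ) : Module.End ℚ (MvPolynomial ℕ ℚ) where
  toFun := Dop g
  map_add' := dop_add g
  map_smul' := dop_smul g

/-- The derivation `x_b ↦ coef a b • x_{a+b}`, the polarization of `𝒟` against `x_a`. -/
def merge (a : ℕ) : Derivation ℚ (MvPolynomial ℕ ℚ) (MvPolynomial ℕ ℚ) :=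
  mkDerivation ℚ fun b => coef a b • X (a + b)

lemma merge_X (a b : ℕ) : merge a (X b) = coef a b • X (a + b) := mkDerivation_X _ _ _

lemma derivation_sum_apply {ι : Type*} (s : Finset ι)
    (D : ι → Derivation ℚ (MvPolynomial ℕ ℚ) (MvPolynomial ℕ ℚ)) (p : MvPolynomial ℕ ℚ) :
    (∑ i ∈ s, D i) p = ∑ i ∈ s, D i p := by
  rw [← Derivation.coeFnAddMonoidHom_apply, map_sum, Finset.sum_apply]
  rfl

lemma merge_eq_sum (a : ℕ) {N : ℕ} {p : MvPolynomial ℕ ℚ} (h : p.vars.sup id < N) :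
    merge a p = ∑ b ∈ Finset.range N, coef a b • (X (a + b) * pderiv b p) := by
  have key : merge a p = (∑ b ∈ Finset.range N,
      (coef a b • (X (a + b) : MvPolynomial ℕ ℚ)) • pderiv (R := ℚ) b) p := by
    refine derivation_eq_of_forall_mem_vars fun i hi => ?_
    have hi' : i < N := (Finset.le_sup (f := id) hi).trans_lt h
    rw [merge_X, derivation_sum_apply, Finset.sum_eq_single i]
    · simp
    · intro b _ hb
      simp [pderiv_X_of_ne hb.symm]
    · intro hb
      exact absurd (Finset.mem_range.2 hi') hb
  rw [key, derivation_sum_apply]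
  simp

lemma dop_X_mul (g a : ℕ) (q : MvPolynomial ℕ ℚ) :
    Dop g (X a * q) = (if a = 0 then -(g : ℚ) else 0) • q + X a * Dop g q + merge a q := by
  set N := q.vars.sup id + (X a * q).vars.sup id + a + 1
  rw [dop_eq_dopCut g (N := N) (by omega), dop_eq_dopCut g (p := q) (N := N) (by omega),
    merge_eq_sum a (N := N) (by omega)]
  have haN : a ∈ Finset.range N := Finset.mem_range.2 (by omega)
  have hd : ∀ b c, pderiv b (pderiv c (X a * q)) =
      X a * pderiv b (pderiv c q) + (if b = a then pderiv c q else 0)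
        + (if c = a then pderiv b q else 0) := by
    intro b c
    by_cases hb : b = a <;> by_cases hc : c = a <;>
      simp [Derivation.leibniz, pderiv_X, hb, hc]
  have h1 : ∑ b ∈ Finset.range N, ∑ c ∈ Finset.range N,
      coef b c • (X (b + c) * pderiv b (pderiv c (X a * q))) =
      X a * (∑ b ∈ Finset.range N, ∑ c ∈ Finset.range N,
        coef b c • (X (b + c) * pderiv b (pderiv c q)))
      + (2 : ℚ) • ∑ b ∈ Finset.range N, coef a b • (X (a + b) * pderiv b q) := by
    simp only [hd, mul_add, smul_add, Finset.sum_add_distrib, mul_ite, mul_zero, smul_ite,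
      smul_zero]
    rw [two_smul, ← add_assoc]
    congr 1
    · congr 1
      · simp only [Finset.mul_sum, mul_smul_comm]
        refine Finset.sum_congr rfl fun b _ => Finset.sum_congr rfl fun c _ => ?_
        congr 1
        ring
      · rw [Finset.sum_comm]
        simp [haN]
    · refine Finset.sum_congr rfl fun b _ => ?_
      rw [Finset.sum_ite_eq' , if_pos haN, coef_comm, add_comm b a]
  unfold dopCut
  rw [h1]
  by_cases ha : a = 0
  · subst ha
    simp [Derivation.leibniz, mul_add, smul_smul]
    ring
  · simp [Derivation.leibniz, pderiv_X, ha, mul_add, smul_smul, add_assoc]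

lemma dop_X (g a : ℕ) : Dop g (X a) = C (if a = 0 then -(g : ℚ) else 0) := by
  have h := dop_X_mul g a 1
  have h1 : Dop g 1 = 0 := by
    have := dop_eq_dopCut g (N := 1) (p := 1) (by simp)
    simpa [dopCut] using this
  simpa [h1, Algebra.smul_def] using h

/-- The monomial `∏ x_{a+1}` over the multiset of indices `s`. -/
def mprod (s : Multiset ℕ) : MvPolynomial ℕ ℚ := (s.map X).prod

lemma mprod_eq (s : Multiset ℕ) :
    mprod s = monomial (Multiset.toFinsupp s) 1 ∧
      codimW (Multiset.toFinsupp s) = s.sum + s.card ∧ levelW (Multiset.toFinsupp s) = s.sum := by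
  induction s using Multiset.induction with
  | empty => simp [mprod, codimW, levelW]
  | cons a s ih =>
    obtain ⟨h1, h2, h3⟩ := ih
    have hc : Multiset.toFinsupp (a ::ₘ s) = Finsupp.single a 1 + Multiset.toFinsupp s := by
      rw [← Multiset.singleton_add, map_add, Multiset.toFinsupp_singleton]
    refine ⟨?_, ?_, ?_⟩
    · rw [hc, ← one_mul (1 : ℚ), ← monomial_mul, ← h1]
      simp [mprod, X]
    · rw [hc, codimW, Finsupp.sum_add_index' (by simp) (by intros; ring)]
      rw [codimW] at h2
      simp [h2]
      ring
    · rw [hc, levelW, Finsupp.sum_add_index' (by simp) (by intros; ring)]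
      rw [levelW] at h3
      simp [h3]

lemma mprod_mem_Rij (s : Multiset ℕ) : mprod s ∈ Rij (s.sum + s.card) s.sum :=
  Submodule.subset_span ⟨_, (mprod_eq s).2.1, (mprod_eq s).2.2, (mprod_eq s).1⟩

lemma Rij_le {i j : ℕ} {M : Submodule ℚ (MvPolynomial ℕ ℚ)}
    (h : ∀ s : Multiset ℕ, s.sum = j → s.sum + s.card = i → mprod s ∈ M) : Rij i j ≤ M := by
  refine Submodule.span_le.2 ?_
  rintro _ ⟨d, hi, hj, rfl⟩
  obtain ⟨h1, h2, h3⟩ := mprod_eq (Finsupp.toMultiset d)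
  rw [Finsupp.toMultiset_toFinsupp] at h1 h2 h3
  rw [SetLike.mem_coe, ← h1]
  exact h _ (h3.symm.trans hj) (h2.symm.trans hi)

/-- The contribution of `-g ∂₁` on `x_{a+1}`. -/
def eps (g a : ℕ) : ℚ := if a = 0 then -(g : ℚ) else 0

lemma eps_zero (g : ℕ) : eps g 0 = -g := rfl

lemma eps_pos (g : ℕ) {a : ℕ} (h : 1 ≤ a) : eps g a = 0 := if_neg (by omega)

lemma dop_two (g a b : ℕ) : Dop g (X a * X b) =
    eps g a • X b + eps g b • X a + coef a b • X (a + b) := by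
  rw [dop_X_mul, dop_X, merge_X]
  simp only [eps, smul_eq_C_mul]
  ring

lemma dop_three (g a b c : ℕ) : Dop g (X a * (X b * X c)) =
    eps g a • (X b * X c) + eps g b • (X a * X c) + eps g c • (X a * X b)
      + coef a b • (X (a + b) * X c) + coef a c • (X (a + c) * X b)
      + coef b c • (X (b + c) * X a) := by
  rw [dop_X_mul, dop_two, Derivation.leibniz, merge_X, merge_X]
  simp only [eps, smul_eq_C_mul, smul_eq_mul]
  ring

lemma dop_four (g a b c d : ℕ) : Dop g (X a * (X b * (X c * X d))) =
    eps g a • (X b * (X c * X d)) + eps g b • (X a * (X c * X d))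
      + eps g c • (X a * (X b * X d)) + eps g d • (X a * (X b * X c))
      + coef a b • (X (a + b) * (X c * X d)) + coef a c • (X (a + c) * (X b * X d))
      + coef a d • (X (a + d) * (X b * X c)) + coef b c • (X (b + c) * (X a * X d))
      + coef b d • (X (b + d) * (X a * X c)) + coef c d • (X (c + d) * (X a * X b)) := by
  rw [dop_X_mul, dop_three, Derivation.leibniz, Derivation.leibniz, merge_X, merge_X, merge_X]
  simp only [eps, smul_eq_C_mul, smul_eq_mul]
  ring

variable {g j : ℕ} {φ : MvPolynomial ℕ ℚ →ₗ[ℚ] ℚ}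

lemma annihilates_one (hg : g = j + 4) (hj : 5 ≤ j)
    (h : ∀ a b, a + b = j → φ (Dop g (X a * X b)) = 0) : φ (X j) = 0 := by
  have h1 := h 0 j (by omega)
  rw [dop_two, eps_zero, eps_pos g (by omega), coef_zero_left, hg] at h1
  simp only [map_add, map_smul, smul_eq_mul, zero_add] at h1
  push_cast at h1
  linarith

lemma annihilates_three (hg : g = j + 4) (hj : 5 ≤ j)
    (h : ∀ a b c d, a + b + c + d = j → φ (Dop g (X a * (X b * (X c * X d)))) = 0)
    (a b c : ℕ) (habc : a + b + c = j) : φ (X a * (X b * X c)) = 0 := by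
  set f : ℕ → ℕ → ℕ → ℚ := fun a b c => φ (X a * (X b * X c))
  have f12 : ∀ a b c, f a b c = f b a c := fun a b c => congrArg φ (by ring)
  have f23 : ∀ a b c, f a b c = f a c b := fun a b c => congrArg φ (by ring)
  have H : ∀ a b c d, a + b + c + d = j →
      eps g a * f b c d + eps g b * f a c d + eps g c * f a b d + eps g d * f a b c
      + coef a b * f (a + b) c d + coef a c * f (a + c) b d + coef a d * f (a + d) b c
      + coef b c * f (b + c) a d + coef b d * f (b + d) a c + coef c d * f (c + d) a b = 0 := by
    intro a b c d hs
    have := h a b c d hs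
    rw [dop_four] at this
    simpa only [map_add, map_smul, smul_eq_mul] using this
  have hgq : (g : ℚ) = j + 4 := by rw [hg]; push_cast; ring
  have A : ∀ a b, 1 ≤ a → 1 ≤ b → a + b = j → f 0 a b = -(1/2) * coef a b * f j 0 0 := by
    intro a b ha hb hs
    have := H 0 0 a b (by omega)
    have hq : (a : ℚ) + b = j := by exact_mod_cast hs
    rw [eps_zero, eps_pos g ha, eps_pos g hb, coef_zero_left, coef_zero_left, coef_zero_left,
      zero_add, zero_add, zero_add, hs, f12 a 0 b, f12 b 0 a, f23 0 b a, hgq, ← hq] at this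
    push_cast at this
    linarith
  have B : ∀ a b c, 1 ≤ a → 1 ≤ b → 1 ≤ c → a + b + c = j → f a b c = 1/4 * f j 0 0 *
      (coef a b * coef (a + b) c + coef a c * coef (a + c) b + coef b c * coef (b + c) a) := by
    intro a b c ha hb hc hs
    have := H 0 a b c (by omega)
    have hq : (a : ℚ) + b + c = j := by exact_mod_cast hs
    rw [eps_zero, eps_pos g ha, eps_pos g hb, eps_pos g hc, coef_zero_left, coef_zero_left,
      coef_zero_left, zero_add, zero_add, zero_add, hgq, ← hq, f12 (a + b), f12 (a + c),
      f12 (b + c), A (a + b) c (by omega) hc hs, A (a + c) b (by omega) hb (by omega),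
      A (b + c) a (by omega) ha (by omega), f12 b a c, f12 c a b, f23 a c b] at this
    linarith
  have hpos : ∀ a b c, 0 < coef a b * coef (a + b) c + coef a c * coef (a + c) b
      + coef b c * coef (b + c) a := fun a b c => by
    have e := fun a b c => mul_pos (coef_pos a b) (coef_pos (a + b) c)
    exact add_pos (add_pos (e a b c) (e a c b)) (e b c a)
  have t0 : f j 0 0 = 0 := by
    obtain ⟨m, rfl⟩ : ∃ m, j = m + 3 := ⟨j - 3, by omega⟩
    have hm : 1 ≤ m := by omega
    have := H 1 1 1 m (by omega)
    rw [eps_pos g le_rfl, eps_pos g hm, B (1 + 1) 1 m (by omega) le_rfl hm (by omega),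
      B (1 + m) 1 1 (by omega) le_rfl le_rfl (by omega)] at this
    have e1 := mul_pos (coef_pos 1 1) (hpos (1 + 1) 1 m)
    have e2 := mul_pos (coef_pos 1 m) (hpos (1 + m) 1 1)
    refine (mul_eq_zero.1 (?_ : (3/4 * (_ + _)) * f (m + 3) 0 0 = 0)).resolve_left
      (mul_pos (by norm_num) (add_pos e1 e2)).ne'
    linarith
  have Z : ∀ a b, a + b = j → f 0 a b = 0 := by
    intro a b hs
    rcases Nat.eq_zero_or_pos a with rfl | ha
    · rw [← hs, zero_add] at t0
      rw [f23, f12, t0]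
    rcases Nat.eq_zero_or_pos b with rfl | hb
    · rw [← hs, add_zero] at t0
      rw [f12, t0]
    rw [A a b ha hb hs, t0, mul_zero]
  change f a b c = 0
  rcases Nat.eq_zero_or_pos a with rfl | ha
  · exact Z b c (by omega)
  rcases Nat.eq_zero_or_pos b with rfl | hb
  · rw [f12]; exact Z a c (by omega)
  rcases Nat.eq_zero_or_pos c with rfl | hc
  · rw [f23, f12]; exact Z a b (by omega)
  rw [B a b c ha hb hc habc, t0]
  ring

/-- A symmetric system `u` of values on two-part partitions of `j ≥ 5` vanishes as soon as it
satisfies all merging relations coming from three-part partitions. -/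
lemma eq_zero_of_merge_relations (hj : 5 ≤ j) (f : ℕ → ℕ → ℚ) (hf : ∀ a b, f a b = f b a)
    (h : ∀ a b c, 1 ≤ a → 1 ≤ b → 1 ≤ c → a + b + c = j →
      coef a b * f (a + b) c + coef a c * f (a + c) b + coef b c * f (b + c) a = 0)
    (a b : ℕ) (ha : 1 ≤ a) (hb : 1 ≤ b) (hab : a + b = j) : f a b = 0 := by
  set ψ : ℕ → ℚ := fun c => (j - c + 2).factorial * (c + 1).factorial * f (j - c) c with hψ
  have S : ∀ a b c, 1 ≤ a → 1 ≤ b → 1 ≤ c → a + b + c = j → ψ a + ψ b + ψ c = 0 := by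
    intro a b c ha hb hc hs
    have h1 := h a b c ha hb hc hs
    simp only [hψ]
    rw [show j - a = b + c by omega, show j - b = a + c by omega, show j - c = a + b by omega,
      ← coef_mul_factorial, ← coef_mul_factorial, ← coef_mul_factorial]
    linear_combination ((a + 1).factorial * (b + 1).factorial * (c + 1).factorial : ℚ) * h1
  have L : ∀ k, k + 3 ≤ j → ψ (k + 1) = ψ 1 + k * (ψ 2 - ψ 1) := by
    intro k
    induction k with
    | zero => intro; simp
    | succ k ih =>
      intro hk
      have h1 := S (k + 1 + 1) 1 (j - k - 3) (by omega) le_rfl (by omega) (by omega)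
      have h2 := S (k + 1) 2 (j - k - 3) (by omega) (by omega) (by omega) (by omega)
      have h3 := ih (by omega)
      push_cast
      linarith
  obtain ⟨n, rfl⟩ : ∃ n, j = n + 3 := ⟨j - 3, by omega⟩
  have hn : 2 ≤ n := by omega
  have hnq : (2 : ℚ) ≤ n := by exact_mod_cast hn
  have E1 := S 1 1 (n + 1) le_rfl le_rfl (by omega) (by omega)
  have E2 := L n le_rfl
  have E3 : 4 * ψ 2 = (n + 3) * ψ (n + 1) := by
    simp only [hψ]
    rw [show n + 3 - 2 = n + 1 by omega, show n + 3 - (n + 1) = 2 by omega, hf 2 (n + 1),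
      Nat.factorial_succ (n + 2)]
    simp [Nat.factorial]
    ring
  have h1 : ψ 1 = 0 := by
    have : ((n : ℚ) - 1) * (n + 6) * ψ 1 = 0 := by
      rw [E2] at E1 E3
      linear_combination ((n : ℚ) * (n + 3) / 2 - 2) * E1 + (n : ℚ) / 2 * E3
    rcases mul_eq_zero.1 this with h | h
    · rcases mul_eq_zero.1 h with h | h <;> linarith
    · exact h
  have h2 : ψ 2 = 0 := by
    rw [E2, h1] at E1
    have : (n : ℚ) * ψ 2 = 0 := by linarith
    exact (mul_eq_zero.1 this).resolve_left (by linarith)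
  have hfz : ∀ c, 1 ≤ c → c ≤ n + 1 → f (n + 3 - c) c = 0 := by
    intro c hc hc'
    have := L (c - 1) (by omega)
    rw [h1, h2, Nat.sub_add_cancel hc] at this
    simp only [hψ, sub_zero, mul_zero, add_zero] at this
    exact (mul_eq_zero.1 this).resolve_left (by positivity)
  rcases Nat.lt_or_ge (n + 1) b with hb' | hb'
  · rw [hf, ← hfz a ha (by omega), show n + 3 - a = b by omega]
  · rw [← hfz b hb hb', show n + 3 - b = a by omega]

lemma annihilates_two (hg : g = j + 4) (hj : 5 ≤ j)
    (h : ∀ a b c, a + b + c = j → φ (Dop g (X a * (X b * X c))) = 0)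
    (a b : ℕ) (hab : a + b = j) : φ (X a * X b) = 0 := by
  set f : ℕ → ℕ → ℚ := fun a b => φ (X a * X b)
  have f12 : ∀ a b, f a b = f b a := fun a b => congrArg φ (by ring)
  have H : ∀ a b c, a + b + c = j →
      eps g a * f b c + eps g b * f a c + eps g c * f a b
      + coef a b * f (a + b) c + coef a c * f (a + c) b + coef b c * f (b + c) a = 0 := by
    intro a b c hs
    have := h a b c hs
    rw [dop_three] at this
    simpa only [map_add, map_smul, smul_eq_mul] using this
  have Z : f 0 j = 0 := by
    have := H 0 0 j (by omega)
    rw [eps_zero, eps_pos g (by omega), coef_zero_left, coef_zero_left, zero_add, zero_add,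
      f12 j 0, hg] at this
    push_cast at this
    linarith
  change f a b = 0
  rcases Nat.eq_zero_or_pos a with rfl | ha
  · rwa [← hab, zero_add] at Z
  rcases Nat.eq_zero_or_pos b with rfl | hb
  · rw [← hab, add_zero] at Z
    rw [f12, Z]
  refine eq_zero_of_merge_relations hj f f12 (fun a b c ha hb hc hs => ?_) a b ha hb hab
  have := H a b c hs
  rw [eps_pos g ha, eps_pos g hb, eps_pos g hc] at this
  linarith

/-- `𝒟` maps codimension `i + 1` onto codimension `i` in level `g - 4`, for `i < g`. -/
lemma Rij_le_map_dopLin (hg : g = j + 4) (hj : 5 ≤ j) {i : ℕ} (hi : i < g) :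
    Rij i j ≤ (Rij (i + 1) j).map (dopLin g) := by
  intro x hx
  by_contra hmem
  obtain ⟨φ, hφx, hφ⟩ := Submodule.exists_le_ker_of_notMem hmem
  refine hφx (Rij_le (M := LinearMap.ker φ) (fun s hs hc => ?_) hx)
  rw [LinearMap.mem_ker]
  have key : ∀ s : Multiset ℕ, s.sum = j → s.sum + s.card = i + 1 →
      φ (Dop g (mprod s)) = 0 := by
    intro s hs hc
    have := mprod_mem_Rij s
    rw [hc, hs] at this
    exact hφ ⟨_, this, rfl⟩
  have hcard : s.card = 0 ∨ s.card = 1 ∨ s.card = 2 ∨ s.card = 3 := by omega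
  rcases hcard with h0 | h1 | h2 | h3
  · rw [Multiset.card_eq_zero] at h0
    subst h0
    simp at hs
    omega
  · obtain ⟨a, rfl⟩ := Multiset.card_eq_one.1 h1
    simp at hs hc
    subst hs
    simp only [mprod, Multiset.map_singleton, Multiset.prod_singleton]
    refine annihilates_one hg hj fun b c hbc => ?_
    have := key {b, c} (by simp [hbc]) (by simp [hbc]; omega)
    simpa [mprod] using this
  · obtain ⟨a, b, rfl⟩ := Multiset.card_eq_two.1 h2
    simp at hs hc
    simp only [mprod, Multiset.insert_eq_cons, Multiset.map_cons, Multiset.map_singleton,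
      Multiset.prod_cons, Multiset.prod_singleton]
    refine annihilates_two hg hj (fun b c d h => ?_) a b hs
    have := key {b, c, d} (by simp; omega) (by simp; omega)
    simpa [mprod] using this
  · obtain ⟨a, b, c, rfl⟩ := Multiset.card_eq_three.1 h3
    simp at hs hc
    simp only [mprod, Multiset.insert_eq_cons, Multiset.map_cons, Multiset.map_singleton,
      Multiset.prod_cons, Multiset.prod_singleton]
    refine annihilates_three hg hj (fun a b c d h => ?_) a b c (by omega)
    have := key {a, b, c, d} (by simp; omega) (by simp; omega)
    simpa [mprod] using this

lemma Rij_le_map_dopLin_pow (hg : g = j + 4) (hj : 5 ≤ j) (n : ℕ) (hn : n ≤ g) :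
    Rij (g - n) j ≤ (Rij g j).map (dopLin g ^ n) := by
  induction n with
  | zero => rw [pow_zero, Module.End.one_eq_id, Submodule.map_id, Nat.sub_zero]
  | succ n ih =>
    have h1 := Rij_le_map_dopLin hg hj (i := g - (n + 1)) (by omega)
    rw [show g - (n + 1) + 1 = g - n by omega] at h1
    refine h1.trans ((Submodule.map_mono (ih (by omega))).trans ?_)
    rw [← Submodule.map_comp, pow_succ', Module.End.mul_eq_comp]

lemma Rij_le_Fil1Rg (hj : 1 ≤ j) : Rij g j ≤ Fil1Rg g :=
  Submodule.span_mono fun _ ⟨d, hc, hl, hp⟩ => ⟨d, hc, hl ▸ hj, hp⟩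

lemma Rij_le_Rgt {i : ℕ} (hi : g < i) : Rij i j ≤ Rgt g :=
  Submodule.span_mono fun _ ⟨d, hc, _, hp⟩ => ⟨d, hc ▸ hi, hp⟩

end Polishchuk

/-- if `g ≥ 9` then every element of `R` of level `g − 4` lies in `I`;
that is, `𝓡^i_{(g−4)} = 0` for all `i`. -/
theorem stmt6 (g : ℕ) (hg : 9 ≤ g) (i : ℕ) : Rij i (g - 4) ≤ Ipol g := by
  rcases Nat.lt_or_ge g i with hi | hi
  · exact (Polishchuk.Rij_le_Rgt hi).trans le_sup_left
  · have h := Polishchuk.Rij_le_map_dopLin_pow (g := g) (j := g - 4) (by omega) (by omega)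
      (g - i) (by omega)
    rw [Nat.sub_sub_self hi] at h
    refine h.trans (le_trans ?_ le_sup_right)
    refine le_trans ?_ (le_iSup _ (g - i))
    rintro _ ⟨p, hp, rfl⟩
    refine Submodule.subset_span ⟨p, Polishchuk.Rij_le_Fil1Rg (by omega) hp, ?_⟩
    rw [Module.End.pow_apply]
    rfl
end
end

section
/- If g ≥ 9, then the map 𝒟 : M^{g−1}_{(g−4)} → M^{g−2}_{(g−4)} is surjective. -/
/- We model `R = ℚ[x₁, x₂, …]` as `MvPolynomial ℕ ℚ`, the variable of index `v`
representing `x_{v+1}` (so `x_k = X (k-1)` for `k ≥ 1`). -/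

open MvPolynomial

noncomputable section

/-- `M^i_{(j)}`: span of monomials in `x₂, x₃, …` (no `x₁`, i.e. exponent of the
variable of index `0` is zero) of codimension `i` and level `j`. -/
def Mij (i j : ℕ) : Submodule ℚ (MvPolynomial ℕ ℚ) :=
  Submodule.span ℚ
    { p | ∃ d : ℕ →₀ ℕ, d 0 = 0 ∧ codimW d = i ∧ levelW d = j ∧ p = monomial d (1 : ℚ) }

open scoped Nat

/-- A symmetric sequence annihilating all the quadratic forms
`∑ binom(a+b+2, b+1) x_{a+b+1} x_{c+1}` with `a + b + c = n` vanishes. -/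
theorem eq_zero_of_symm_of_choose_relation {n : ℕ} (hn : 5 ≤ n) (f : ℕ → ℚ)
    (hsymm : ∀ c, 1 ≤ c → c < n → f (n - c) = f c)
    (hrel : ∀ a b c, 1 ≤ a → 1 ≤ b → 1 ≤ c → a + b + c = n →
      ((a + b + 2).choose (b + 1) : ℚ) * f c + ((a + c + 2).choose (c + 1) : ℚ) * f b +
        ((b + c + 2).choose (c + 1) : ℚ) * f a = 0) :
    ∀ c, 1 ≤ c → c < n → f c = 0 := by
  obtain ⟨h, hdef⟩ : ∃ h : ℕ → ℚ, ∀ c, h c = ((n - c + 2)! * (c + 1)! : ℚ) * f c :=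
    ⟨_, fun _ => rfl⟩
  have hadd : ∀ a b c, 1 ≤ a → 1 ≤ b → 1 ≤ c → a + b + c = n → h a + h b + h c = 0 := by
    intro a b c ha hb hc habc
    have key : ∀ i j : ℕ, ((i + j + 2).choose (j + 1) : ℚ) * (i + 1)! * (j + 1)! =
        (i + j + 2)! := by
      intro i j
      have := Nat.add_choose_mul_factorial_mul_factorial (i + 1) (j + 1)
      rw [show i + 1 + (j + 1) = i + j + 2 by ring] at this
      exact_mod_cast this
    rw [hdef, hdef, hdef, show n - a = b + c by omega, show n - b = a + c by omega,
      show n - c = a + b by omega, ← key a b, ← key a c, ← key b c]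
    linear_combination ((a + 1)! * (b + 1)! * (c + 1)! : ℚ) * hrel a b c ha hb hc habc
  have haff : ∀ k, k + 3 ≤ n → h (k + 1) = h 1 + k * (h 2 - h 1) := by
    intro k
    induction k with
    | zero => simp
    | succ k ih =>
      intro hk
      have h₁ := hadd (k + 1) 2 (n - (k + 3)) (by omega) (by omega) (by omega) (by omega)
      have h₂ := hadd (k + 1 + 1) 1 (n - (k + 3)) (by omega) (by omega) (by omega) (by omega)
      have h₃ := ih (by omega)
      push_cast
      linear_combination h₂ - h₁ + h₃
  obtain ⟨m, rfl⟩ : ∃ m, n = m + 5 := ⟨n - 5, by omega⟩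
  have hlast := haff (m + 2) (by omega)
  have hsum := hadd 1 1 (m + 2 + 1) le_rfl le_rfl (by omega) (by omega)
  have hquad : 4 * h 2 = (m + 5) * h (m + 2 + 1) := by
    have := hsymm 2 (by omega) (by omega)
    rw [show m + 5 - 2 = m + 2 + 1 by omega] at this
    rw [hdef, hdef, this, show m + 5 - 2 + 2 = (m + 4) + 1 by omega,
      show m + 5 - (m + 2 + 1) + 2 = 4 by omega, show m + 2 + 1 + 1 = m + 4 by omega,
      Nat.factorial_succ (m + 4)]
    norm_num [Nat.factorial]
    ring
  push_cast at hlast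
  have hd : h 2 - h 1 = 0 := by
    have hpos : ((m : ℚ) + 1) * (m + 8) ≠ 0 := by positivity
    refine (mul_eq_zero.mp (?_ : ((m : ℚ) + 1) * (m + 8) * (h 2 - h 1) = 0)).resolve_left hpos
    rw [hlast] at hsum hquad
    linear_combination (-3 / 2) * hquad - ((m + 1) / 2 : ℚ) * hsum
  have h1 : h 1 = 0 := by
    rw [hlast, hd] at hsum
    linarith
  have hzero : ∀ c, 1 ≤ c → c + 2 ≤ m + 5 → f c = 0 := by
    intro c hc hcn
    have := haff (c - 1) (by omega)
    rw [Nat.sub_add_cancel hc, hd, h1, hdef] at this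
    have hpos : ((m + 5 - c + 2)! * (c + 1)! : ℚ) ≠ 0 := by positivity
    simpa [Nat.factorial_ne_zero] using this
  intro c hc hcn
  rcases Nat.lt_or_ge (c + 1) (m + 5) with hlt | hge
  · exact hzero c hc hlt
  · rw [← hsymm c hc hcn]
    exact hzero _ (by omega) (by omega)

/-- The operator `Dop` with a fixed cut-off `N`, as a linear map. -/
def DopTrunc (g N : ℕ) : MvPolynomial ℕ ℚ →ₗ[ℚ] MvPolynomial ℕ ℚ :=
  -(g : ℚ) • (pderiv 0).toLinearMap +
    (1/2 : ℚ) •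
      ∑ a ∈ Finset.range N, ∑ b ∈ Finset.range N,
        (((a + b + 2).choose (b + 1) : ℚ)) •
          (LinearMap.mulLeft ℚ (X (a + b)) ∘ₗ (pderiv a).toLinearMap ∘ₗ (pderiv b).toLinearMap)

theorem DopTrunc_apply (g N : ℕ) (p : MvPolynomial ℕ ℚ) :
    DopTrunc g N p = -(g : ℚ) • pderiv 0 p +
      (1/2 : ℚ) • ∑ a ∈ Finset.range N, ∑ b ∈ Finset.range N,
        (((a + b + 2).choose (b + 1) : ℚ)) • (X (a + b) * pderiv a (pderiv b p)) := by
  simp [DopTrunc, LinearMap.sum_apply]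

theorem Dop_eq_DopTrunc (g N : ℕ) (p : MvPolynomial ℕ ℚ) (hp : ∀ v ∈ p.vars, v < N) :
    Dop g p = DopTrunc g N p := by
  rw [DopTrunc_apply, Dop]
  congr 2
  have hb : ∀ b, b ∉ p.vars → pderiv b p = 0 := fun b => pderiv_eq_zero_of_notMem_vars
  have hcomm : ∀ a b, pderiv a (pderiv b p) = pderiv b (pderiv a p) := by
    intro a b
    have : ⁅pderiv (R := ℚ) a, pderiv b⁆ = 0 := derivation_ext fun i => by
      rw [Derivation.commutator_apply]
      simp [pderiv_X, Pi.single_apply, apply_ite]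
    have := DFunLike.congr_fun this p
    rwa [Derivation.commutator_apply, Derivation.zero_apply, sub_eq_zero] at this
  have hterm : ∀ a b, (a ∉ p.vars ∨ b ∉ p.vars) →
      (((a + b + 2).choose (b + 1) : ℚ)) • (X (a + b) * pderiv a (pderiv b p)) = 0 := by
    rintro a b (h | h)
    · rw [hcomm, hb a h]; simp
    · rw [hb b h]; simp
  have hsub : ∀ M, (∀ v ∈ p.vars, v < M) →
      ∑ a ∈ Finset.range M, ∑ b ∈ Finset.range M,
        (((a + b + 2).choose (b + 1) : ℚ)) • (X (a + b) * pderiv a (pderiv b p)) =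
      ∑ a ∈ p.vars, ∑ b ∈ p.vars,
        (((a + b + 2).choose (b + 1) : ℚ)) • (X (a + b) * pderiv a (pderiv b p)) := by
    intro M hM
    have hM' : p.vars ⊆ Finset.range M := fun v hv => Finset.mem_range.mpr (hM v hv)
    rw [← Finset.sum_subset hM' fun a _ ha =>
      Finset.sum_eq_zero fun b _ => hterm a b (Or.inl ha)]
    exact Finset.sum_congr rfl fun a _ =>
      (Finset.sum_subset hM' fun b _ hb => hterm a b (Or.inr hb)).symm
  rw [hsub N hp, hsub]
  exact fun v hv => Nat.lt_succ_of_le (Finset.le_sup (f := id) hv)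

theorem lt_of_mem_vars_of_mem_Mij {i j : ℕ} {p : MvPolynomial ℕ ℚ} (hp : p ∈ Mij i j) :
    ∀ v ∈ p.vars, v < j + 1 := by
  have hle : Mij i j ≤ Subalgebra.toSubmodule (supported ℚ (Set.Iio (j + 1))) := by
    refine Submodule.span_le.mpr ?_
    rintro _ ⟨d, -, -, hd, rfl⟩
    rw [SetLike.mem_coe, Subalgebra.mem_toSubmodule, mem_supported,
      vars_monomial one_ne_zero]
    intro v hv
    have hv' : d v ≠ 0 := Finsupp.mem_support_iff.mp hv
    have h₁ : v * d v ≤ levelW d :=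
      Finset.single_le_sum (f := fun v => v * d v) (fun _ _ => Nat.zero_le _) hv
    have h₂ : v ≤ v * d v := Nat.le_mul_of_pos_right v (Nat.pos_of_ne_zero hv')
    exact Set.mem_Iio.mpr (by omega)
  have := mem_supported.mp (hle hp)
  exact fun v hv => this hv

theorem DopTrunc_X_mul_X_mul_X (g N : ℕ) {a b c : ℕ} (ha : 1 ≤ a) (hb : 1 ≤ b) (hc : 1 ≤ c)
    (haN : a < N) (hbN : b < N) (hcN : c < N) :
    DopTrunc g N (X a * X b * X c) =
      ((a + b + 2).choose (b + 1) : ℚ) • (X c * X (a + b)) +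
      ((a + c + 2).choose (c + 1) : ℚ) • (X b * X (a + c)) +
      ((b + c + 2).choose (c + 1) : ℚ) • (X a * X (b + c)) := by
  have hX : ∀ p q : ℕ, pderiv p (X q : MvPolynomial ℕ ℚ) = if p = q then 1 else 0 := by
    intro p q
    rw [pderiv_X, Pi.single_apply]
    simp [eq_comm]
  have hite : ∀ (p : ℕ) (P : Prop) [Decidable P],
      pderiv p (if P then (1 : MvPolynomial ℕ ℚ) else 0) = 0 := by
    intro p P _
    split_ifs <;> simp
  have hch : ∀ p q : ℕ, (p + q + 2).choose (p + 1) = (p + q + 2).choose (q + 1) := by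
    intro p q
    rw [show p + q + 2 = (p + 1) + (q + 1) by ring, Nat.choose_symm_add]
  have hXX : ∀ p q : ℕ, pderiv p (pderiv q (X a * X b * X c : MvPolynomial ℕ ℚ)) =
      (if q = a then 1 else 0) * ((if p = b then 1 else 0) * X c + (if p = c then 1 else 0) * X b) +
      (if q = b then 1 else 0) * ((if p = a then 1 else 0) * X c + (if p = c then 1 else 0) * X a) +
      (if q = c then 1 else 0) *
        ((if p = a then 1 else 0) * X b + (if p = b then 1 else 0) * X a) := by
    intro p q
    simp only [Derivation.leibniz, smul_eq_mul, map_add, hX, hite]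
    ring
  have hX0 : pderiv 0 (X a * X b * X c : MvPolynomial ℕ ℚ) = 0 := by
    simp [Derivation.leibniz, hX, show 0 ≠ a by omega, show 0 ≠ b by omega, show 0 ≠ c by omega]
  rw [DopTrunc_apply, hX0, Finset.sum_comm]
  simp only [hXX, mul_add, ite_mul, one_mul, zero_mul, mul_ite, mul_zero,
    smul_add, smul_ite, smul_zero, Finset.sum_add_distrib, Finset.sum_ite_eq',
    Finset.mem_range, haN, hbN, hcN, if_true]
  rw [add_comm b a, add_comm c a, add_comm c b, hch a b, hch a c, hch b c,
    mul_comm (X c), mul_comm (X b), mul_comm (X a)]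
  module

theorem exists_eq_add_of_codimW_eq_levelW_add_two {d : ℕ →₀ ℕ}
    (h : codimW d = levelW d + 2) :
    ∃ u v, d = Finsupp.single u 1 + Finsupp.single v 1 := by
  have hcard : Multiset.card (Finsupp.toMultiset d) = 2 := by
    have : codimW d = levelW d + d.sum fun _ => id := by
      simp [codimW, levelW, Finsupp.sum, add_mul, Finset.sum_add_distrib]
    rw [Finsupp.card_toMultiset]
    omega
  obtain ⟨u, v, huv⟩ := Multiset.card_eq_two.mp hcard
  refine ⟨u, v, Multiset.toFinsupp.symm.injective ?_⟩
  change Finsupp.toMultiset d = Finsupp.toMultiset _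
  rw [huv, map_add, Finsupp.toMultiset_single, Finsupp.toMultiset_single]
  simp

theorem X_mul_X_mul_X_mem_Mij {a b c : ℕ} (ha : 1 ≤ a) (hb : 1 ≤ b) (hc : 1 ≤ c) :
    (X a * X b * X c : MvPolynomial ℕ ℚ) ∈ Mij (a + b + c + 3) (a + b + c) := by
  refine Submodule.subset_span
    ⟨Finsupp.single a 1 + Finsupp.single b 1 + Finsupp.single c 1, ?_, ?_, ?_, ?_⟩
  · simp [Finsupp.single_apply]
    omega
  · simp [codimW, Finsupp.sum_add_index', mul_add]
    ring
  · simp [levelW, Finsupp.sum_add_index', mul_add]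
  · simp [X, monomial_mul]

/-- if `g ≥ 9` then `𝒟 : M^{g−1}_{(g−4)} → M^{g−2}_{(g−4)}` is
surjective. -/
theorem stmt8 (g : ℕ) (hg : 9 ≤ g) :
    ∀ y ∈ Mij (g - 2) (g - 4), ∃ x ∈ Mij (g - 1) (g - 4), Dop g x = y := by
  obtain ⟨n, rfl⟩ : ∃ n, g = n + 4 := ⟨g - 4, by omega⟩
  rw [show n + 4 - 2 = n + 2 by omega, show n + 4 - 1 = n + 3 by omega, Nat.add_sub_cancel]
  suffices hle : Mij (n + 2) n ≤ (Mij (n + 3) n).map (DopTrunc (n + 4) (n + 1)) by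
    intro y hy
    obtain ⟨x, hx, rfl⟩ := hle hy
    exact ⟨x, hx, Dop_eq_DopTrunc _ _ _ (lt_of_mem_vars_of_mem_Mij hx)⟩
  refine Submodule.span_le.mpr ?_
  rintro _ ⟨d, hd0, hcodim, hlevel, rfl⟩
  obtain ⟨u, v, rfl⟩ := exists_eq_add_of_codimW_eq_levelW_add_two (hcodim.trans (by rw [hlevel]))
  have huv : u + v = n := by
    simpa [levelW, Finsupp.sum_add_index', mul_add] using hlevel
  have hu : 1 ≤ u := by
    by_contra! h
    simp [show u = 0 by omega] at hd0
  have hv : 1 ≤ v := by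
    by_contra! h
    simp [show v = 0 by omega] at hd0
  by_contra hnot
  obtain ⟨ψ, hψ, hker⟩ := Submodule.exists_le_ker_of_notMem hnot
  refine hψ ?_
  have := eq_zero_of_symm_of_choose_relation (n := n) (by omega)
    (fun c => ψ (X c * X (n - c)))
    (fun c h₁ h₂ => by rw [mul_comm, Nat.sub_sub_self h₂.le])
    (fun a b c ha hb hc habc => by
      have hmem := hker (Submodule.mem_map_of_mem (f := DopTrunc (n + 4) (n + 1))
        (habc ▸ X_mul_X_mul_X_mem_Mij ha hb hc))
      rw [LinearMap.mem_ker, DopTrunc_X_mul_X_mul_X _ _ ha hb hc (by omega) (by omega)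
        (by omega)] at hmem
      rw [show n - c = a + b by omega, show n - b = a + c by omega, show n - a = b + c by omega]
      simpa using hmem)
    u hu (by omega)
  rw [show n - u = v by omega] at this
  simpa [X, monomial_mul] using this
end
end
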